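/- Let K be a field of characteristic zero and d_1, d_2 positive integers. There exists a nonempty Zariski open subset U ⊂ V_{2,d_1} × V_{2,d_2} such that for every pair (g_1, g_2) ∈ U, the Newton polytope of the minimal polynomial f_min of the elimination ideal I_g ∩ K[x_1^{(∞)}], where I_g = ⟨x_1' − g_1(x_1,x_2), x_2' − g_2(x_1,x_2)⟩^(∞), is exactly the following polytope (in the exponent coordinates (e_0, e_1, e_2) of monomials x_1^{e_0}(x_1')^{e_1}(x_1'')^{e_2}, with e_i ≥ 0): if d_1 ≤ d_2, the polytope given by e_0 + d_1 e_1 + (d_1 + d_2 − 1) e_2 ≤ d_1(d_1 + d_2 − 1); if d_1 > d_2, the polytope given by the two inequalities e_0 + d_1 e_1 + (2d_1 − 1) e_2 ≤ d_1(2d_1 − 1) and e_0 + d_2 e_1 + (d_1 + d_2 − 1) e_2 ≤ d_1(d_1 + d_2 − 1). -/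

import Mathlib

open MvPolynomial

noncomputable section

/-- The canonical derivation on the ring of differential polynomials
`K[x_i^{(j)} : 1 ≤ i ≤ n, j ≥ 0]`, sending `x_i^{(j)}` to `x_i^{(j+1)}`. -/
def diffDer (K : Type*) [CommRing K] (n : ℕ) :
    Derivation K (MvPolynomial (Fin n × ℕ) K) (MvPolynomial (Fin n × ℕ) K) :=
  MvPolynomial.mkDerivation K fun v => X (v.1, v.2 + 1)

/-- The differential ideal generated by a set `S`: the ideal generated by all
derivatives of elements of `S`. -/
def diffIdeal (K : Type*) [CommRing K] (n : ℕ) (S : Set (MvPolynomial (Fin n × ℕ) K)) :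
    Ideal (MvPolynomial (Fin n × ℕ) K) :=
  Ideal.span {q | ∃ f ∈ S, ∃ j : ℕ, q = (⇑(diffDer K n))^[j] f}

/-- The differential ideal `I_g = ⟨x_1' - g_1, …, x_n' - g_n⟩^(∞)` of the
system `x' = g(x)`. -/
def sysIdeal (K : Type*) [CommRing K] (n : ℕ) (g : Fin n → MvPolynomial (Fin n) K) :
    Ideal (MvPolynomial (Fin n × ℕ) K) :=
  diffIdeal K n (Set.range fun i => X (i, 1) - rename (fun j => (j, 0)) (g i))

/-- The order of a differential polynomial: the largest `j` such that some variable
`x_i^{(j)}` appears. -/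
def ordOf {K : Type*} [CommSemiring K] {n : ℕ} (f : MvPolynomial (Fin n × ℕ) K) : ℕ :=
  f.vars.sup Prod.snd

/-- `f` is a minimal polynomial of the elimination ideal `I ∩ K[x_1^{(∞)}]`:
a nonzero element of `I` involving only the variables `x_1^{(j)}`, of minimal order and
then minimal total degree among all such elements. -/
def IsMinPoly (K : Type*) [Field K] (n : ℕ) [NeZero n]
    (I : Ideal (MvPolynomial (Fin n × ℕ) K)) (f : MvPolynomial (Fin n × ℕ) K) : Prop :=
  f ≠ 0 ∧ f ∈ I ∧ (∀ v ∈ f.vars, v.1 = (0 : Fin n)) ∧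
    ∀ h : MvPolynomial (Fin n × ℕ) K, h ≠ 0 → h ∈ I → (∀ v ∈ h.vars, v.1 = (0 : Fin n)) →
      ordOf f ≤ ordOf h ∧ (ordOf h ≤ ordOf f → f.totalDegree ≤ h.totalDegree)

/-- The set of exponent vectors `(e_0, …, e_ν)` of the monomials
`x_1^{e_0} (x_1')^{e_1} ⋯ (x_1^{(ν)})^{e_ν}` of a differential polynomial in `x_1`. -/
def expVecs (K : Type*) [CommSemiring K] (n ν : ℕ) [NeZero n]
    (f : MvPolynomial (Fin n × ℕ) K) : Set (Fin (ν + 1) → ℝ) :=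
  {e | ∃ m ∈ f.support, e = fun k : Fin (ν + 1) => (m ((0 : Fin n), (k : ℕ)) : ℝ)}

/-- The Newton polytope of a differential polynomial in `x_1` of order at most `ν`. -/
def newtonPolytope (K : Type*) [CommSemiring K] (n ν : ℕ) [NeZero n]
    (f : MvPolynomial (Fin n × ℕ) K) : Set (Fin (ν + 1) → ℝ) :=
  convexHull ℝ (expVecs K n ν f)

/-- Every monomial of `p` has `w`-weight at most `N`. -/
def WeightLE {σ A : Type*} [CommRing A] (w : σ → ℕ) (p : MvPolynomial σ A) (N : ℤ) : Prop :=
  ∀ m ∈ p.support, (Finsupp.weight w m : ℤ) ≤ N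

namespace WeightLE

variable {σ A : Type*} [CommRing A] {w : σ → ℕ} {p q : MvPolynomial σ A} {M N : ℤ}

theorem mono (h : WeightLE w p M) (hMN : M ≤ N) : WeightLE w p N :=
  fun m hm => (h m hm).trans hMN

theorem zero : WeightLE w (0 : MvPolynomial σ A) N := by
  intro m hm
  simp at hm

theorem eq_zero (h : WeightLE w p N) (hN : N < 0) : p = 0 := by
  by_contra hp
  obtain ⟨m, hm⟩ := MvPolynomial.support_nonempty.2 hp
  have := h m hm
  omega

theorem add (hp : WeightLE w p N) (hq : WeightLE w q N) : WeightLE w (p + q) N := by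
  classical
  intro m hm
  rcases Finset.mem_union.1 (MvPolynomial.support_add hm) with h | h
  exacts [hp m h, hq m h]

theorem neg (hp : WeightLE w p N) : WeightLE w (-p) N := by
  intro m hm
  rw [MvPolynomial.support_neg] at hm
  exact hp m hm

theorem mul (hp : WeightLE w p M) (hq : WeightLE w q N) : WeightLE w (p * q) (M + N) := by
  classical
  intro m hm
  obtain ⟨a, ha, b, hb, rfl⟩ := Finset.mem_add.1 (MvPolynomial.support_mul p q hm)
  rw [map_add, Nat.cast_add]
  exact add_le_add (hp a ha) (hq b hb)

theorem C (a : A) (hN : 0 ≤ N) : WeightLE w (MvPolynomial.C a) N := by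
  classical
  intro m hm
  rw [MvPolynomial.mem_support_iff, MvPolynomial.coeff_C] at hm
  obtain rfl : 0 = m := by
    by_contra h
    simp [h] at hm
  simpa using hN

theorem X (i : σ) (hN : (w i : ℤ) ≤ N) : WeightLE w (MvPolynomial.X i : MvPolynomial σ A) N := by
  classical
  intro m hm
  rw [MvPolynomial.mem_support_iff, MvPolynomial.coeff_X] at hm
  obtain rfl : Finsupp.single i 1 = m := by
    by_contra h
    simp [h] at hm
  simpa [Finsupp.weight_single] using hN

theorem sum {ι : Type*} (s : Finset ι) (f : ι → MvPolynomial σ A)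
    (h : ∀ i ∈ s, WeightLE w (f i) N) : WeightLE w (∑ i ∈ s, f i) N := by
  classical
  induction s using Finset.induction_on with
  | empty => simpa using zero
  | insert a s ha ih =>
    rw [Finset.sum_insert ha]
    exact (h a (by simp)).add (ih fun i hi => h i (by simp [hi]))

theorem prod {ι : Type*} (s : Finset ι) (f : ι → MvPolynomial σ A) (N : ι → ℤ)
    (h : ∀ i ∈ s, WeightLE w (f i) (N i)) : WeightLE w (∏ i ∈ s, f i) (∑ i ∈ s, N i) := by
  classical
  induction s using Finset.induction_on with
  | empty => simpa using C (w := w) (1 : A) le_rfl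
  | insert a s ha ih =>
    rw [Finset.prod_insert ha, Finset.sum_insert ha]
    exact (h a (by simp)).mul (ih fun i hi => h i (by simp [hi]))

theorem det {ι : Type*} [Fintype ι] [DecidableEq ι] (B : Matrix ι ι (MvPolynomial σ A))
    (r s : ι → ℤ) (h : ∀ i j, WeightLE w (B i j) (r i + s j)) :
    WeightLE w B.det (∑ i, r i + ∑ j, s j) := by
  rw [Matrix.det_apply]
  refine sum _ _ fun τ _ => ?_
  have key : WeightLE w (∏ i, B (τ i) i) (∑ i, r i + ∑ j, s j) := by
    have := prod Finset.univ (fun i => B (τ i) i) (fun i => r (τ i) + s i)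
      fun i _ => h (τ i) i
    rwa [Finset.sum_add_distrib, Equiv.sum_comp τ r] at this
  rcases Int.units_eq_one_or (Equiv.Perm.sign τ) with h1 | h1 <;> rw [h1]
  · simpa using key
  · simpa using key.neg

end WeightLE

/-- The coefficient of `Y ^ i` in `f` has `w`-weight at most `N - i`. -/
def PolyWeightLE {σ A : Type*} [CommRing A] (w : σ → ℕ) (f : Polynomial (MvPolynomial σ A))
    (N : ℤ) : Prop :=
  ∀ i : ℕ, WeightLE w (f.coeff i) (N - i)

namespace PolyWeightLE

variable {σ A : Type*} [CommRing A] {w : σ → ℕ} {f g : Polynomial (MvPolynomial σ A)} {M N : ℤ}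

theorem mono (h : PolyWeightLE w f M) (hMN : M ≤ N) : PolyWeightLE w f N :=
  fun i => (h i).mono (by omega)

theorem sub (hf : PolyWeightLE w f N) (hg : PolyWeightLE w g N) : PolyWeightLE w (f - g) N := by
  intro i
  rw [Polynomial.coeff_sub, sub_eq_add_neg]
  exact (hf i).add (hg i).neg

theorem mul (hf : PolyWeightLE w f M) (hg : PolyWeightLE w g N) :
    PolyWeightLE w (f * g) (M + N) := by
  intro i
  rw [Polynomial.coeff_mul]
  refine WeightLE.sum _ _ fun x hx => ((hf x.1).mul (hg x.2)).mono ?_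
  have hx' : x.1 + x.2 = i := by simpa using hx
  omega

theorem C {p : MvPolynomial σ A} (hp : WeightLE w p N) : PolyWeightLE w (Polynomial.C p) N := by
  intro i
  rw [Polynomial.coeff_C]
  split_ifs with h
  · simpa [h] using hp
  · exact WeightLE.zero

theorem X : PolyWeightLE w (Polynomial.X : Polynomial (MvPolynomial σ A)) 1 := by
  intro i
  rw [Polynomial.coeff_X]
  split_ifs with h
  · subst h
    simpa using WeightLE.C (w := w) (1 : A) le_rfl
  · exact WeightLE.zero

theorem pow (hf : PolyWeightLE w f N) (k : ℕ) : PolyWeightLE w (f ^ k) (k * N) := by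
  induction k with
  | zero => simpa using PolyWeightLE.C (WeightLE.C (w := w) (1 : A) le_rfl)
  | succ k ih =>
    rw [pow_succ]
    exact (ih.mul hf).mono (by push_cast; linarith)

theorem sum {ι : Type*} (s : Finset ι) (f : ι → Polynomial (MvPolynomial σ A))
    (h : ∀ i ∈ s, PolyWeightLE w (f i) N) : PolyWeightLE w (∑ i ∈ s, f i) N := by
  intro k
  rw [Polynomial.finsetSum_coeff]
  exact WeightLE.sum _ _ fun i hi => h i hi k

theorem natDegree_le {n : ℕ} (h : PolyWeightLE w f n) : f.natDegree ≤ n :=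
  Polynomial.natDegree_le_iff_coeff_eq_zero.2 fun i hi => (h i).eq_zero (by omega)

theorem resultant {m n : ℕ} (hf : PolyWeightLE w f M) (hg : PolyWeightLE w g N) :
    WeightLE w (Polynomial.resultant f g m n) (n * M + m * N - m * n) := by
  have h := WeightLE.det (w := w) (Polynomial.sylvester f g m n) (fun i => -((i : ℕ) : ℤ))
    (fun j => j.addCases (fun k => N + ((k : ℕ) : ℤ)) (fun k => M + ((k : ℕ) : ℤ))) ?_
  · refine h.mono (le_of_eq ?_)
    rw [Fin.sum_univ_add, Fin.sum_univ_add]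
    simp [Finset.sum_add_distrib]
    ring
  · intro i j
    induction j using Fin.addCases with
    | left j =>
      simp only [Polynomial.sylvester, Matrix.of_apply, Fin.addCases_left, Set.mem_Icc]
      split_ifs with hij
      · exact (hg _).mono (by omega)
      · exact WeightLE.zero
    | right j =>
      simp only [Polynomial.sylvester, Matrix.of_apply, Fin.addCases_right, Set.mem_Icc]
      split_ifs with hij
      · exact (hf _).mono (by omega)
      · exact WeightLE.zero

end PolyWeightLE

section Eliminant

variable {A B : Type*} [CommRing A] [CommRing B]

/-- A polynomial in `x₁, x₂` as a polynomial in `Y = x₂` over `A[x₁'', x₁, x₁']`. -/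
def liftY : MvPolynomial (Fin 2) A →ₐ[A] Polynomial (MvPolynomial (Fin 3) A) :=
  aeval ![Polynomial.C (X 1), Polynomial.X]

/-- `g₁ - x₁'` as a polynomial in `Y`. -/
def velocityPoly (g₁ : MvPolynomial (Fin 2) A) : Polynomial (MvPolynomial (Fin 3) A) :=
  liftY g₁ - Polynomial.C (X 2)

/-- `x₁'' - x₁' ∂₁g₁ - g₂ ∂₂g₁` as a polynomial in `Y`. -/
def accelPoly (g₁ g₂ : MvPolynomial (Fin 2) A) : Polynomial (MvPolynomial (Fin 3) A) :=
  Polynomial.C (X 0) - Polynomial.C (X 2) * liftY (pderiv 0 g₁) - liftY (pderiv 1 g₁) * liftY g₂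

/-- The eliminant of `x₂`, with variables `x₁'', x₁, x₁'` in this order. -/
def eliminant (d₁ d₂ : ℕ) (g₁ g₂ : MvPolynomial (Fin 2) A) : MvPolynomial (Fin 3) A :=
  Polynomial.resultant (velocityPoly g₁) (accelPoly g₁ g₂) d₁ (d₁ + d₂ - 1)

theorem map_liftY (φ : A →+* B) (g : MvPolynomial (Fin 2) A) :
    (liftY g).map (MvPolynomial.map φ) = liftY (MvPolynomial.map φ g) := by
  induction g using MvPolynomial.induction_on with
  | C a => simp [liftY, algebraMap_eq, Polynomial.algebraMap_apply]
  | add p q hp hq => simp [hp, hq]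
  | mul_X p i hp =>
    rw [map_mul, Polynomial.map_mul, hp, map_mul, map_mul]
    congr 1
    fin_cases i <;> simp [liftY]

theorem map_eliminant (φ : A →+* B) (d₁ d₂ : ℕ) (g₁ g₂ : MvPolynomial (Fin 2) A) :
    MvPolynomial.map φ (eliminant d₁ d₂ g₁ g₂) =
      eliminant d₁ d₂ (MvPolynomial.map φ g₁) (MvPolynomial.map φ g₂) := by
  have hv : (velocityPoly g₁).map (MvPolynomial.map φ) = velocityPoly (MvPolynomial.map φ g₁) := by
    simp [velocityPoly, map_liftY]
  have ha : (accelPoly g₁ g₂).map (MvPolynomial.map φ) =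
      accelPoly (MvPolynomial.map φ g₁) (MvPolynomial.map φ g₂) := by
    simp [accelPoly, map_liftY, pderiv_map]
  rw [eliminant, eliminant, ← hv, ← ha, Polynomial.resultant_map_map]

theorem polyWeightLE_liftY (w : Fin 3 → ℕ) (hw : w 1 = 1) (g : MvPolynomial (Fin 2) A) (N : ℤ)
    (h : ∀ m ∈ g.support, ((m 0 + m 1 : ℕ) : ℤ) ≤ N) : PolyWeightLE w (liftY g) N := by
  rw [liftY, aeval_def, eval₂_eq]
  refine PolyWeightLE.sum _ _ fun m hm => ?_
  have h1 : PolyWeightLE w (algebraMap A (Polynomial (MvPolynomial (Fin 3) A)) (g.coeff m)) 0 := by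
    rw [Polynomial.algebraMap_apply, algebraMap_eq]
    exact .C (.C _ le_rfl)
  have h2 : PolyWeightLE w (Polynomial.C (X 1) : Polynomial (MvPolynomial (Fin 3) A)) 1 :=
    .C (.X _ (by simp [hw]))
  have h3 := h1.mul ((h2.pow (m 0)).mul ((PolyWeightLE.X (A := A) (w := w)).pow (m 1)))
  rw [Finset.prod_subset (Finset.subset_univ _) fun i _ hi => by
    rw [Finsupp.notMem_support_iff.1 hi, pow_zero], Fin.prod_univ_two]
  refine h3.mono ?_
  have := h m hm
  push_cast at this
  linarith

theorem degree_le_of_mem_support_pderiv (g : MvPolynomial (Fin 2) A) (d : ℕ)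
    (h : ∀ m ∈ g.support, m 0 + m 1 ≤ d) (i : Fin 2) :
    ∀ m ∈ (pderiv i g).support, ((m 0 + m 1 : ℕ) : ℤ) ≤ d - 1 := by
  intro m hm
  rw [mem_support_iff, coeff_pderiv] at hm
  have h1 := h (m + Finsupp.single i 1) (mem_support_iff.2 fun h0 => hm (by simp [h0]))
  fin_cases i <;> simp at h1 <;> push_cast <;> omega

section Bounds

variable {d₁ d₂ : ℕ} {g₁ g₂ : MvPolynomial (Fin 2) A} {w : Fin 3 → ℕ}

theorem polyWeightLE_velocityPoly (hw : w 1 = 1) (hw2 : w 2 ≤ d₁)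
    (h₁ : ∀ m ∈ g₁.support, m 0 + m 1 ≤ d₁) : PolyWeightLE w (velocityPoly g₁) d₁ :=
  (polyWeightLE_liftY w hw g₁ d₁ fun m hm => by exact_mod_cast h₁ m hm).sub
    (.C (.X _ (by exact_mod_cast hw2)))

theorem polyWeightLE_accelPoly (hd : 0 < d₁) (hw : w 1 = 1) {N : ℕ} (hw0 : w 0 ≤ N)
    (hw2 : w 2 + (d₁ - 1) ≤ N) (hN : d₁ + d₂ - 1 ≤ N)
    (h₁ : ∀ m ∈ g₁.support, m 0 + m 1 ≤ d₁) (h₂ : ∀ m ∈ g₂.support, m 0 + m 1 ≤ d₂) :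
    PolyWeightLE w (accelPoly g₁ g₂) N := by
  have hp := fun i => polyWeightLE_liftY w hw _ _ (degree_le_of_mem_support_pderiv g₁ d₁ h₁ i)
  refine ((PolyWeightLE.C (.X _ (by exact_mod_cast hw0))).sub ?_).sub ?_
  · exact ((PolyWeightLE.C (.X (N := w 2) _ le_rfl)).mul (hp 0)).mono (by omega)
  · exact ((hp 1).mul (polyWeightLE_liftY w hw g₂ d₂ fun m hm => by exact_mod_cast h₂ m hm)).mono
      (by omega)

theorem weightLE_eliminant (hd : 0 < d₁) (hw : w 1 = 1) {N : ℕ} (hw0 : w 0 ≤ N) (hw2' : w 2 ≤ d₁)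
    (hw2 : w 2 + (d₁ - 1) ≤ N) (hN : d₁ + d₂ - 1 ≤ N)
    (h₁ : ∀ m ∈ g₁.support, m 0 + m 1 ≤ d₁) (h₂ : ∀ m ∈ g₂.support, m 0 + m 1 ≤ d₂) :
    WeightLE w (eliminant d₁ d₂ g₁ g₂) (d₁ * N) := by
  refine ((polyWeightLE_velocityPoly hw hw2' h₁).resultant
    (polyWeightLE_accelPoly hd hw hw0 hw2 hN h₁ h₂)).mono ?_
  exact le_of_eq (by ring)

theorem natDegree_velocityPoly_le (h₁ : ∀ m ∈ g₁.support, m 0 + m 1 ≤ d₁) :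
    (velocityPoly g₁).natDegree ≤ d₁ :=
  (polyWeightLE_velocityPoly (w := ![0, 1, 0]) rfl (Nat.zero_le _) h₁).natDegree_le

theorem natDegree_accelPoly_le (hd : 0 < d₁)
    (h₁ : ∀ m ∈ g₁.support, m 0 + m 1 ≤ d₁) (h₂ : ∀ m ∈ g₂.support, m 0 + m 1 ≤ d₂) :
    (accelPoly g₁ g₂).natDegree ≤ d₁ + d₂ - 1 :=
  (polyWeightLE_accelPoly (w := ![0, 1, 0]) hd rfl (Nat.zero_le _) (by simp; omega) le_rfl
    h₁ h₂).natDegree_le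

end Bounds

/-- The evaluation of `liftY g` at a point whose `x₁`-coordinate is `a`. -/
theorem eval_map_liftY [Algebra A B] (v : Fin 3 → B) (b : B) (g : MvPolynomial (Fin 2) A) :
    ((liftY g).map (aeval v : MvPolynomial (Fin 3) A →ₐ[A] B).toRingHom).eval b =
      aeval ![v 1, b] g := by
  induction g using MvPolynomial.induction_on with
  | C a => simp [liftY, algebraMap_eq, Polynomial.algebraMap_apply]
  | add p q hp hq => simpa using congrArg₂ (· + ·) hp hq
  | mul_X p i hp =>
    rw [map_mul, Polynomial.map_mul, Polynomial.eval_mul, hp, map_mul]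
    congr 1
    fin_cases i <;> simp [liftY]

theorem eval_map_velocityPoly [Algebra A B] (v : Fin 3 → B) (b : B)
    (g₁ : MvPolynomial (Fin 2) A) :
    ((velocityPoly g₁).map (aeval v : MvPolynomial (Fin 3) A →ₐ[A] B).toRingHom).eval b =
      aeval ![v 1, b] g₁ - v 2 := by
  rw [velocityPoly, Polynomial.map_sub, Polynomial.eval_sub, eval_map_liftY]
  simp

theorem eval_map_accelPoly [Algebra A B] (v : Fin 3 → B) (b : B)
    (g₁ g₂ : MvPolynomial (Fin 2) A) :
    ((accelPoly g₁ g₂).map (aeval v : MvPolynomial (Fin 3) A →ₐ[A] B).toRingHom).eval b =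
      v 0 - v 2 * aeval ![v 1, b] (pderiv 0 g₁) -
        aeval ![v 1, b] (pderiv 1 g₁) * aeval ![v 1, b] g₂ := by
  rw [accelPoly, Polynomial.map_sub, Polynomial.map_sub, Polynomial.map_mul, Polynomial.map_mul,
    Polynomial.eval_sub, Polynomial.eval_sub, Polynomial.eval_mul, Polynomial.eval_mul]
  simp only [eval_map_liftY]
  simp

/-- The second derivative of `x₁` along the vector field `(g₁, g₂)`. -/
def accel (g₁ g₂ : MvPolynomial (Fin 2) A) : MvPolynomial (Fin 2) A :=
  g₁ * pderiv 0 g₁ + g₂ * pderiv 1 g₁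

theorem aeval_eliminant (d₁ d₂ : ℕ) (hd : 0 < d₁) (g₁ g₂ : MvPolynomial (Fin 2) A)
    (h₁ : ∀ m ∈ g₁.support, m 0 + m 1 ≤ d₁) (h₂ : ∀ m ∈ g₂.support, m 0 + m 1 ≤ d₂) :
    aeval ![accel g₁ g₂, X 0, g₁] (eliminant d₁ d₂ g₁ g₂) = 0 := by
  obtain ⟨p, q, -, -, hpq⟩ := Polynomial.exists_mul_add_mul_eq_C_resultant _ _
    (natDegree_velocityPoly_le h₁) (natDegree_accelPoly_le hd h₁ h₂) (Or.inl hd.ne')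
  set v : Fin 3 → MvPolynomial (Fin 2) A := ![accel g₁ g₂, X 0, g₁] with hv
  have h := congrArg (fun r => (r.map (aeval v : MvPolynomial (Fin 3) A →ₐ[A] _).toRingHom).eval
    (X 1)) hpq
  simp only [Polynomial.map_add, Polynomial.map_mul, Polynomial.eval_add, Polynomial.eval_mul,
    eval_map_velocityPoly, eval_map_accelPoly, Polynomial.map_C, Polynomial.eval_C] at h
  have hX : (![v 1, X 1] : Fin 2 → MvPolynomial (Fin 2) A) = X := by
    ext i : 1
    fin_cases i <;> simp [hv]
  have hid : ∀ g : MvPolynomial (Fin 2) A, aeval ![v 1, X 1] g = g := by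
    intro g
    rw [hX, aeval_X_left_apply]
  simp only [hid] at h
  change _ = aeval v (eliminant d₁ d₂ g₁ g₂) at h
  have e₁ : g₁ - v 2 = 0 := by simp [hv]
  have e₂ : v 0 - v 2 * pderiv 0 g₁ - pderiv 1 g₁ * g₂ = 0 := by
    simp only [hv, accel, Matrix.cons_val]
    ring
  rw [← h, e₁, e₂, zero_mul, zero_mul, add_zero]

end Eliminant

section Divisibility

theorem Polynomial.dvd_of_eval₂_eq_zero_of_minimal {R S : Type*} [CommRing R] [IsDomain R]
    [IsIntegrallyClosed R] [CommRing S] [IsDomain S] (φ : R →+* S) (hφ : Function.Injective φ)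
    (s : S) {P : Polynomial R} (hlead : IsUnit P.leadingCoeff) (hP : P.eval₂ φ s = 0)
    (hmin : ∀ μ : Polynomial R, μ.Monic → μ.eval₂ φ s = 0 → P.natDegree ≤ μ.natDegree)
    {q : Polynomial R} (hq : q.eval₂ φ s = 0) : P ∣ q := by
  let _ := φ.toAlgebra
  have : FaithfulSMul R S := (faithfulSMul_iff_algebraMap_injective R S).2 hφ
  obtain ⟨u, hu⟩ := hlead
  have hu' : (↑u⁻¹ : R) * P.leadingCoeff = 1 := by rw [← hu, Units.inv_mul]
  have hmonic : (Polynomial.C (↑u⁻¹ : R) * P).Monic :=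
    Polynomial.monic_C_mul_of_mul_leadingCoeff_eq_one hu'
  have hroot : Polynomial.aeval s (Polynomial.C (↑u⁻¹ : R) * P) = 0 := by
    rw [map_mul, Polynomial.aeval_def s P]
    exact (congrArg _ hP).trans (mul_zero _)
  have hint : IsIntegral R s := ⟨_, hmonic, hroot⟩
  have hdeg : (Polynomial.C (↑u⁻¹ : R) * P).degree = P.degree :=
    Polynomial.degree_C_mul_of_isUnit (Units.isUnit _) _
  have heq := minpoly.IsIntegrallyClosed.unique_of_degree_le_degree_minpoly hmonic hroot (by
    rw [hdeg]
    have := hmin _ (minpoly.monic hint) (minpoly.aeval R s)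
    rw [Polynomial.degree_eq_natDegree (minpoly.ne_zero hint)]
    exact Polynomial.degree_le_natDegree.trans (by exact_mod_cast this))
  have hdvd : minpoly R s ∣ q := minpoly.isIntegrallyClosed_dvd hint hq
  rw [← heq] at hdvd
  exact (Dvd.intro_left _ rfl).trans hdvd

theorem weight_fin_three (w : Fin 3 → ℕ) (m : Fin 3 →₀ ℕ) :
    Finsupp.weight w m = m 0 * w 0 + m 1 * w 1 + m 2 * w 2 := by
  rw [Finsupp.weight_apply, Finsupp.sum_fintype _ _ (by simp), Fin.sum_univ_three]
  simp

theorem coeff_aeval_top {A S : Type*} [CommRing A] [CommRing S] [Algebra A S] (a : S) {d : ℕ}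
    (g : MvPolynomial (Fin 2) A) (h : ∀ m ∈ g.support, m 0 + m 1 ≤ d) :
    (aeval ![Polynomial.C a, Polynomial.X] g : Polynomial S).coeff d =
      algebraMap A S (g.coeff (Finsupp.single 1 d)) := by
  classical
  rw [aeval_def, eval₂_eq, Polynomial.finsetSum_coeff]
  have hterm : ∀ m ∈ g.support, ((algebraMap A (Polynomial S) (g.coeff m)) *
      ∏ i ∈ m.support, (![Polynomial.C a, Polynomial.X] : Fin 2 → Polynomial S) i ^ m i).coeff d =
      if m = Finsupp.single 1 d then algebraMap A S (g.coeff m) else 0 := by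
    intro m hm
    have hm' := h m hm
    rw [Finset.prod_subset (Finset.subset_univ _) fun i _ hi => by
      rw [Finsupp.notMem_support_iff.1 hi, pow_zero], Fin.prod_univ_two]
    simp only [Matrix.cons_val_zero, Matrix.cons_val_one]
    rw [Polynomial.algebraMap_apply, Polynomial.coeff_C_mul, ← Polynomial.C_pow,
      Polynomial.coeff_C_mul, Polynomial.coeff_X_pow]
    split_ifs with h1 h2 h2
    · have : m 0 = 0 := by omega
      simp [this]
    · exact absurd (by ext i; fin_cases i <;> simp <;> omega) h2
    · exact absurd (by rw [h2]; simp) h1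
    · simp
  rw [Finset.sum_congr rfl hterm, Finset.sum_ite_eq']
  split_ifs with h1
  · rfl
  · rw [notMem_support_iff.1 h1, map_zero]

theorem injective_aeval_of_coeff_ne_zero {K : Type*} [Field K] {d : ℕ} (hd : 0 < d)
    (g : MvPolynomial (Fin 2) K) (h : ∀ m ∈ g.support, m 0 + m 1 ≤ d)
    (hc : g.coeff (Finsupp.single 1 d) ≠ 0) :
    Function.Injective (aeval ![X 0, g] : MvPolynomial (Fin 2) K →ₐ[K] MvPolynomial (Fin 2) K) := by
  set ψ : MvPolynomial (Fin 2) K →ₐ[K] Polynomial (Polynomial K) :=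
    aeval ![Polynomial.C Polynomial.X, Polynomial.X] with hψ
  have hψinj : Function.Injective ψ := by
    have hleft : ∀ p, Polynomial.eval₂ (Polynomial.aeval (X 0 : MvPolynomial (Fin 2) K)).toRingHom
        (X 1) (ψ p) = p := by
      intro p
      induction p using MvPolynomial.induction_on with
      | C a => simp [hψ, algebraMap_eq, Polynomial.algebraMap_apply]
      | add p q hp hq => rw [map_add, Polynomial.eval₂_add, hp, hq]
      | mul_X p i hp =>
        rw [map_mul, Polynomial.eval₂_mul, hp]
        congr 1
        fin_cases i <;> simp [hψ]
    exact Function.LeftInverse.injective hleft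
  have hcomp : ∀ p, ψ (aeval ![X 0, g] p) = (ψ p).comp (ψ g) := by
    intro p
    induction p using MvPolynomial.induction_on with
    | C a => simp [hψ, Polynomial.algebraMap_apply]
    | add p q hp hq => rw [map_add, map_add, hp, hq, map_add, Polynomial.add_comp]
    | mul_X p i hp =>
      rw [map_mul, map_mul, hp, map_mul, Polynomial.mul_comp]
      congr 1
      fin_cases i <;> simp [hψ]
  rw [injective_iff_map_eq_zero]
  intro p hp
  have h0 : (ψ p).comp (ψ g) = 0 := by rw [← hcomp, hp, map_zero]
  rcases Polynomial.comp_eq_zero_iff.1 h0 with h1 | ⟨-, h1⟩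
  · exact hψinj (by rw [h1, map_zero])
  · exfalso
    have h2 := coeff_aeval_top (Polynomial.X : Polynomial K) g h
    rw [← hψ, h1, Polynomial.coeff_C_of_ne_zero hd.ne', Polynomial.algebraMap_apply] at h2
    exact hc (by simpa using h2.symm)

variable {K : Type*} [Field K] {d₁ d₂ : ℕ} {g₁ g₂ : MvPolynomial (Fin 2) K}

theorem exists_common_root_of_aeval_eliminant {L : Type*} [Field L] [IsAlgClosed L] [Algebra K L]
    (hd : 0 < d₁) (h₁ : ∀ m ∈ g₁.support, m 0 + m 1 ≤ d₁)
    (h₂ : ∀ m ∈ g₂.support, m 0 + m 1 ≤ d₂) (hc : g₁.coeff (Finsupp.single 1 d₁) ≠ 0)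
    (v : Fin 3 → L) (hv : aeval v (eliminant d₁ d₂ g₁ g₂) = 0) :
    ∃ y : L, aeval ![v 1, y] g₁ = v 2 ∧ aeval ![v 1, y] (accel g₁ g₂) = v 0 := by
  set φ := (aeval v : MvPolynomial (Fin 3) K →ₐ[K] L).toRingHom with hφ
  set f := (velocityPoly g₁).map φ with hf
  set a := (accelPoly g₁ g₂).map φ with ha
  have hres : Polynomial.resultant f a d₁ (d₁ + d₂ - 1) = 0 := by
    rw [hf, ha, Polynomial.resultant_map_map]
    exact hv
  have hcoeff : f.coeff d₁ ≠ 0 := by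
    rw [hf, Polynomial.coeff_map, velocityPoly, Polynomial.coeff_sub,
      Polynomial.coeff_C_of_ne_zero hd.ne', liftY, coeff_aeval_top _ _ h₁, sub_zero, algebraMap_eq]
    simpa [hφ] using hc
  have hdeg : f.natDegree = d₁ :=
    le_antisymm (Polynomial.natDegree_map_le.trans (natDegree_velocityPoly_le h₁))
      (Polynomial.le_natDegree_of_ne_zero hcoeff)
  have hadeg : a.natDegree ≤ d₁ + d₂ - 1 :=
    Polynomial.natDegree_map_le.trans (natDegree_accelPoly_le hd h₁ h₂)
  obtain ⟨k, hk⟩ := Nat.exists_eq_add_of_le hadeg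
  rw [hk, Polynomial.resultant_add_right_deg _ _ _ _ _ le_rfl, ← hdeg] at hres
  have hres' := (mul_eq_zero.1 hres).resolve_left (pow_ne_zero _ (by rwa [hdeg]))
  have hcop := (Polynomial.resultant_eq_zero_iff.1 hres').2
  rw [Polynomial.isCoprime_iff_aeval_ne_zero_of_isAlgClosed L L] at hcop
  push Not at hcop
  obtain ⟨y, hy₁, hy₂⟩ := hcop
  rw [Polynomial.coe_aeval_eq_eval, hf, eval_map_velocityPoly] at hy₁
  rw [Polynomial.coe_aeval_eq_eval, ha, eval_map_accelPoly] at hy₂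
  refine ⟨y, sub_eq_zero.1 hy₁, ?_⟩
  rw [accel, map_add, map_mul, map_mul]
  linear_combination aeval ![v 1, y] (pderiv 0 g₁) * hy₁ - hy₂

/-- The eliminant on the line `x₁ = 0`, `x₁' = 1`. -/
def eliminantLine {A : Type*} [CommRing A] (d₁ d₂ : ℕ) (g₁ g₂ : MvPolynomial (Fin 2) A) :
    Polynomial A :=
  aeval ![Polynomial.X, 0, 1] (eliminant d₁ d₂ g₁ g₂)

theorem map_finSuccEquiv_eq_aeval {A : Type*} [CommRing A] (F : MvPolynomial (Fin 3) A) :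
    (finSuccEquiv A 2 F).map (aeval ![0, 1] : MvPolynomial (Fin 2) A →ₐ[A] A).toRingHom =
      aeval ![Polynomial.X, 0, 1] F := by
  induction F using MvPolynomial.induction_on with
  | C a => simp [finSuccEquiv_apply]
  | add p q hp hq => simpa using congrArg₂ (· + ·) hp hq
  | mul_X p i hp =>
    rw [map_mul, Polynomial.map_mul, hp, map_mul]
    congr 1
    rw [aeval_X]
    fin_cases i
    · exact (congrArg _ (finSuccEquiv_X_zero (R := A) (n := 2))).trans (by simp)
    · exact (congrArg _ (finSuccEquiv_X_succ (R := A) (n := 2) (j := 0))).trans (by simp)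
    · exact (congrArg _ (finSuccEquiv_X_succ (R := A) (n := 2) (j := 1))).trans (by simp)

theorem eval₂_finSuccEquiv_eq_aeval {A S : Type*} [CommRing A] [CommRing S] [Algebra A S]
    (a b c : S)
    (F : MvPolynomial (Fin 3) A) :
    (finSuccEquiv A 2 F).eval₂ (aeval ![b, c] : MvPolynomial (Fin 2) A →ₐ[A] S).toRingHom a =
      aeval ![a, b, c] F := by
  induction F using MvPolynomial.induction_on with
  | C a => simp [finSuccEquiv_apply]
  | add p q hp hq => rw [map_add, Polynomial.eval₂_add, hp, hq, map_add]
  | mul_X p i hp =>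
    rw [map_mul, Polynomial.eval₂_mul, hp, map_mul]
    congr 1
    rw [aeval_X]
    fin_cases i
    · exact (congrArg _ (finSuccEquiv_X_zero (R := A) (n := 2))).trans (by simp)
    · exact (congrArg _ (finSuccEquiv_X_succ (R := A) (n := 2) (j := 0))).trans (by simp)
    · exact (congrArg _ (finSuccEquiv_X_succ (R := A) (n := 2) (j := 1))).trans (by simp)

theorem weight_bound_eliminant {A : Type*} [CommRing A] {g₁ g₂ : MvPolynomial (Fin 2) A}
    (hd : 0 < d₁) {N k : ℕ} (hk : k ≤ d₁)
    (hk' : k + (d₁ - 1) ≤ N) (hN : d₁ + d₂ - 1 ≤ N)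
    (h₁ : ∀ m ∈ g₁.support, m 0 + m 1 ≤ d₁) (h₂ : ∀ m ∈ g₂.support, m 0 + m 1 ≤ d₂)
    {m : Fin 3 →₀ ℕ} (hm : m ∈ (eliminant d₁ d₂ g₁ g₂).support) :
    m 0 * N + m 1 + m 2 * k ≤ d₁ * N := by
  have h := weightLE_eliminant (w := ![N, 1, k]) hd rfl le_rfl hk hk' hN h₁ h₂ m hm
  rw [weight_fin_three] at h
  simp only [Matrix.cons_val] at h
  zify
  push_cast at h
  linarith

theorem eliminant_dvd (hd : 0 < d₁) (hd₂ : 0 < d₂)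
    (h₁ : ∀ m ∈ g₁.support, m 0 + m 1 ≤ d₁)
    (h₂ : ∀ m ∈ g₂.support, m 0 + m 1 ≤ d₂) (hc : g₁.coeff (Finsupp.single 1 d₁) ≠ 0)
    (hlead : (eliminant d₁ d₂ g₁ g₂).coeff (Finsupp.single 0 d₁) ≠ 0)
    (hsep : Polynomial.resultant (eliminantLine d₁ d₂ g₁ g₂)
      (Polynomial.derivative (eliminantLine d₁ d₂ g₁ g₂)) d₁ (d₁ - 1) ≠ 0)
    {q : MvPolynomial (Fin 3) K} (hq : aeval ![accel g₁ g₂, X 0, g₁] q = 0) :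
    eliminant d₁ d₂ g₁ g₂ ∣ q := by
  classical
  set F := eliminant d₁ d₂ g₁ g₂ with hF
  set P := finSuccEquiv K 2 F with hP
  set E := eliminantLine d₁ d₂ g₁ g₂ with hE
  have hbound : ∀ m ∈ F.support, m 0 * (d₁ + d₂ - 1) + m 1 + m 2 ≤ d₁ * (d₁ + d₂ - 1) := by
    intro m hm
    simpa using weight_bound_eliminant (k := 1) hd (by omega) (by omega) le_rfl h₁ h₂ hm
  have hPdeg_le : P.natDegree ≤ d₁ := by
    rw [hP, natDegree_finSuccEquiv, degreeOf_le_iff]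
    intro m hm
    have := hbound m hm
    exact Nat.le_of_mul_le_mul_right (by omega : m 0 * (d₁ + d₂ - 1) ≤ d₁ * (d₁ + d₂ - 1))
      (by omega)
  have hPcoeff : P.coeff d₁ = C (F.coeff (Finsupp.single 0 d₁)) := by
    ext m
    rw [hP, finSuccEquiv_coeff_coeff, coeff_C]
    split_ifs with hm
    · subst hm
      congr 1
      ext i
      refine Fin.cases ?_ (fun j => ?_) i <;> simp
    · by_contra hne
      have := hbound _ (mem_support_iff.2 hne)
      apply hm
      have e0 : (Finsupp.cons d₁ m : Fin 3 →₀ ℕ) 0 = d₁ := Finsupp.cons_zero _ _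
      have e1 : (Finsupp.cons d₁ m : Fin 3 →₀ ℕ) 1 = m 0 := Finsupp.cons_succ 0 _ _
      have e2 : (Finsupp.cons d₁ m : Fin 3 →₀ ℕ) 2 = m 1 := Finsupp.cons_succ 1 _ _
      rw [e0, e1, e2] at this
      ext i
      fin_cases i <;> simp <;> omega
  have hPdeg : P.natDegree = d₁ := le_antisymm hPdeg_le
    (Polynomial.le_natDegree_of_ne_zero (by rw [hPcoeff]; simpa using hlead))
  have hPE : P.map (aeval ![0, 1] : MvPolynomial (Fin 2) K →ₐ[K] K).toRingHom = E :=
    map_finSuccEquiv_eq_aeval F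
  have hEdeg : E.natDegree = d₁ := by
    refine le_antisymm (hPE ▸ Polynomial.natDegree_map_le.trans hPdeg_le)
      (Polynomial.le_natDegree_of_ne_zero ?_)
    rw [← hPE, Polynomial.coeff_map, hPcoeff]
    simpa using hlead
  have hEsep : E.Separable := by
    obtain ⟨a, b, -, -, hab⟩ := Polynomial.exists_mul_add_mul_eq_C_resultant (m := d₁)
      (n := d₁ - 1) E (Polynomial.derivative E) hEdeg.le
      ((Polynomial.natDegree_derivative_le E).trans (by rw [hEdeg])) (Or.inl hd.ne')
    set r := Polynomial.resultant E (Polynomial.derivative E) d₁ (d₁ - 1)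
    refine ⟨Polynomial.C r⁻¹ * a, Polynomial.C r⁻¹ * b, ?_⟩
    calc _ = Polynomial.C r⁻¹ * (E * a + Polynomial.derivative E * b) := by ring
      _ = 1 := by rw [hab, ← Polynomial.C_mul, inv_mul_cancel₀ hsep, Polynomial.C_1]
  set φ : MvPolynomial (Fin 2) K →+* MvPolynomial (Fin 2) K :=
    (aeval ![X 0, g₁] : MvPolynomial (Fin 2) K →ₐ[K] MvPolynomial (Fin 2) K).toRingHom with hφ
  have hmin : ∀ μ : Polynomial (MvPolynomial (Fin 2) K), μ.Monic →
      μ.eval₂ φ (accel g₁ g₂) = 0 → P.natDegree ≤ μ.natDegree := by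
    intro μ hμ hμ0
    let L := AlgebraicClosure K
    set ε := (aeval ![0, 1] : MvPolynomial (Fin 2) K →ₐ[K] K).toRingHom with hε
    have hμ' : (μ.map ε).Monic := hμ.map _
    have hsub : E.rootSet L ⊆ (μ.map ε).rootSet L := by
      intro l hl
      rw [Polynomial.mem_rootSet] at hl ⊢
      refine ⟨hμ'.ne_zero, ?_⟩
      have hl' : aeval ![l, 0, 1] F = 0 := by
        refine Eq.trans ?_ hl.2
        change _ = ((Polynomial.aeval l).comp (aeval ![Polynomial.X, 0, 1])) F
        congr 1
        ext i
        fin_cases i <;> simp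
      obtain ⟨y, hy₁, hy₂⟩ := exists_common_root_of_aeval_eliminant hd h₁ h₂ hc _ hl'
      simp only [Matrix.cons_val] at hy₁ hy₂
      have h0 := congrArg (aeval ![0, y] : MvPolynomial (Fin 2) K →ₐ[K] L).toRingHom hμ0
      rw [Polynomial.hom_eval₂, map_zero] at h0
      have hcomp : (aeval ![0, y] : MvPolynomial (Fin 2) K →ₐ[K] L).toRingHom.comp φ =
          (algebraMap K L).comp ε := by
        have : ((aeval ![0, y] : MvPolynomial (Fin 2) K →ₐ[K] L).comp
            (aeval ![X 0, g₁] : MvPolynomial (Fin 2) K →ₐ[K] MvPolynomial (Fin 2) K)) =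
            (Algebra.ofId K L).comp (aeval ![0, 1] : MvPolynomial (Fin 2) K →ₐ[K] K) := by
          ext i
          fin_cases i
          · simp
          · simp [hy₁]
        exact congrArg AlgHom.toRingHom this
      rw [hcomp] at h0
      rw [Polynomial.aeval_def, Polynomial.eval₂_map]
      refine Eq.trans ?_ h0
      congr 1
      exact hy₂.symm
    have hcard := Polynomial.card_rootSet_eq_natDegree (K := L) hEsep (IsAlgClosed.splits _)
    rw [hPdeg, ← hEdeg, ← hcard]
    calc Fintype.card (E.rootSet L) ≤ Fintype.card ((μ.map ε).rootSet L) :=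
          Fintype.card_le_of_injective _ (Set.inclusion_injective hsub)
      _ ≤ ((μ.map ε).map (algebraMap K L)).natDegree := by
          rw [← Nat.card_eq_fintype_card, Nat.card_coe_set_eq, Polynomial.rootSet_def,
            Set.ncard_coe_finset]
          exact (Multiset.toFinset_card_le _).trans (Polynomial.card_roots' _)
      _ ≤ μ.natDegree := Polynomial.natDegree_map_le.trans Polynomial.natDegree_map_le
  have hdvd : P ∣ finSuccEquiv K 2 q := by
    refine Polynomial.dvd_of_eval₂_eq_zero_of_minimal φ
      (injective_aeval_of_coeff_ne_zero hd g₁ h₁ hc) (accel g₁ g₂) ?_ ?_ hmin ?_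
    · rw [Polynomial.leadingCoeff, hPdeg, hPcoeff]
      exact (isUnit_iff_ne_zero.2 hlead).map C
    · rw [hP, hφ, eval₂_finSuccEquiv_eq_aeval]
      exact aeval_eliminant d₁ d₂ hd g₁ g₂ h₁ h₂
    · rw [hφ, eval₂_finSuccEquiv_eq_aeval]
      exact hq
  exact (map_dvd_iff (finSuccEquiv K 2)).1 hdvd

end Divisibility

theorem map_liftY_aeval {A B : Type*} [CommRing A] [CommRing B] [Algebra A B] (v : Fin 3 → B)
    (g : MvPolynomial (Fin 2) A) :
    (liftY g).map (aeval v : MvPolynomial (Fin 3) A →ₐ[A] B).toRingHom =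
      aeval ![Polynomial.C (v 1), Polynomial.X] g := by
  induction g using MvPolynomial.induction_on with
  | C a => simp [liftY, algebraMap_eq, Polynomial.algebraMap_apply]
  | add p q hp hq => simpa using congrArg₂ (· + ·) hp hq
  | mul_X p i hp =>
    rw [map_mul, Polynomial.map_mul, hp, map_mul]
    congr 1
    fin_cases i <;> simp [liftY]

theorem aeval_eliminant_eq_resultant {A B : Type*} [CommRing A] [CommRing B] [Algebra A B]
    (d₁ d₂ : ℕ) (v : Fin 3 → B) (g₁ g₂ : MvPolynomial (Fin 2) A) :
    aeval v (eliminant d₁ d₂ g₁ g₂) =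
      Polynomial.resultant
        (aeval ![Polynomial.C (v 1), Polynomial.X] g₁ - Polynomial.C (v 2))
        (Polynomial.C (v 0) -
          Polynomial.C (v 2) * aeval ![Polynomial.C (v 1), Polynomial.X] (pderiv 0 g₁) -
          aeval ![Polynomial.C (v 1), Polynomial.X] (pderiv 1 g₁) *
            aeval ![Polynomial.C (v 1), Polynomial.X] g₂) d₁ (d₁ + d₂ - 1) := by
  have h := Polynomial.resultant_map_map (velocityPoly g₁) (accelPoly g₁ g₂) d₁ (d₁ + d₂ - 1)
    (aeval v : MvPolynomial (Fin 3) A →ₐ[A] B).toRingHom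
  rw [velocityPoly, accelPoly, Polynomial.map_sub, Polynomial.map_sub, Polynomial.map_sub,
    Polynomial.map_mul, Polynomial.map_mul, map_liftY_aeval, map_liftY_aeval, map_liftY_aeval,
    map_liftY_aeval, Polynomial.map_C, Polynomial.map_C] at h
  have hX : ∀ i, (aeval v : MvPolynomial (Fin 3) A →ₐ[A] B).toRingHom (X i) = v i := fun i =>
    aeval_X v i
  rw [hX, hX] at h
  exact h.symm

theorem Polynomial.resultant_C_mul_X_pow {R : Type*} [CommRing R] (f : Polynomial R) {m k N : ℕ}
    (hf : f.natDegree ≤ m) (hk : k ≤ N) (c : R) :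
    Polynomial.resultant f (Polynomial.C c * Polynomial.X ^ k) m N =
      f.coeff m ^ (N - k) * (c ^ m * ((-1) ^ (m * k) * f.coeff 0 ^ k)) := by
  obtain ⟨j, rfl⟩ := Nat.exists_eq_add_of_le hk
  rw [Polynomial.resultant_add_right_deg _ _ _ _ _ (Polynomial.natDegree_C_mul_X_pow_le c k),
    Polynomial.resultant_C_mul_right, Polynomial.resultant_X_pow_right _ _ _ hf,
    Nat.add_sub_cancel_left]

/-- Setting variables absent from `m` to zero does not change the coefficient of `m`. -/
theorem coeff_aeval_of_eq_X_or_zero {σ A : Type*} [Fintype σ] [CommRing A] (p : MvPolynomial σ A)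
    (m : σ →₀ ℕ) (v : σ → MvPolynomial σ A) (hv : ∀ i, v i = X i ∨ (v i = 0 ∧ m i = 0)) :
    coeff m (aeval v p) = coeff m p := by
  classical
  induction p using MvPolynomial.induction_on' with
  | monomial m' a =>
    rw [aeval_monomial, algebraMap_eq, coeff_C_mul, Finsupp.prod_fintype _ _ (by simp)]
    by_cases h : ∀ i, v i = X i ∨ m' i = 0
    · have : ∏ i, v i ^ m' i = monomial m' (1 : A) := by
        rw [monomial_eq, Finsupp.prod_fintype _ _ (by simp), C_1, one_mul]
        refine Finset.prod_congr rfl fun i _ => ?_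
        rcases h i with h | h <;> simp [h]
      rw [this]
      simp [coeff_monomial]
    · push Not at h
      obtain ⟨i, hi, hi'⟩ := h
      have hv' := (hv i).resolve_left hi
      rw [Finset.prod_eq_zero (Finset.mem_univ i) (by rw [hv'.1, zero_pow hi']), coeff_monomial,
        if_neg (fun h => hi' (by rw [h]; exact hv'.2))]
      simp
  | add p q hp hq => rw [map_add, coeff_add, coeff_add, hp, hq]

theorem Polynomial.resultant_X_pow_sub_C_monomial {R : Type*} [CommRing R] {n k N : ℕ}
    (hn : 0 < n) (hk : k ≤ N) (a c : R) :
    Polynomial.resultant (Polynomial.X ^ n - Polynomial.C a)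
      (Polynomial.C c * Polynomial.X ^ k) n N = (-1) ^ (n * k + k) * (c ^ n * a ^ k) := by
  rw [Polynomial.resultant_C_mul_X_pow _
    (Polynomial.natDegree_sub_C.le.trans (Polynomial.natDegree_X_pow_le n)) hk]
  have h₁ : (Polynomial.X ^ n - Polynomial.C a).coeff n = 1 := by
    simp [Polynomial.coeff_C, hn.ne']
  have h₂ : (Polynomial.X ^ n - Polynomial.C a).coeff 0 = -a := by simp [hn.ne]
  rw [h₁, h₂, neg_pow a, pow_add]
  ring

section Examples

variable {K : Type*} [Field K] {d₁ : ℕ} (d₂ : ℕ)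

theorem coeff_eliminant_ne_zero_of_monomial (hd : 0 < d₁) (g₁ g₂ : MvPolynomial (Fin 2) K)
    (v : Fin 3 → MvPolynomial (Fin 3) K) (m : Fin 3 →₀ ℕ)
    (hv : ∀ i, v i = X i ∨ (v i = 0 ∧ m i = 0)) {k : ℕ} (hk : k ≤ d₁ + d₂ - 1)
    (a : MvPolynomial (Fin 3) K) (ma mc : Fin 3 →₀ ℕ) (c : K) (hc : c ≠ 0)
    (ha : a ^ k = monomial ma 1) (hm : m = d₁ • mc + ma)
    (hvel : aeval ![Polynomial.C (v 1), Polynomial.X] g₁ - Polynomial.C (v 2) =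
      Polynomial.X ^ d₁ - Polynomial.C a)
    (hacc : Polynomial.C (v 0) -
      Polynomial.C (v 2) * aeval ![Polynomial.C (v 1), Polynomial.X] (pderiv 0 g₁) -
      aeval ![Polynomial.C (v 1), Polynomial.X] (pderiv 1 g₁) *
        aeval ![Polynomial.C (v 1), Polynomial.X] g₂ =
      Polynomial.C (monomial mc c) * Polynomial.X ^ k) :
    coeff m (eliminant d₁ d₂ g₁ g₂) ≠ 0 := by
  rw [← coeff_aeval_of_eq_X_or_zero _ _ v hv, aeval_eliminant_eq_resultant, hvel, hacc,
    Polynomial.resultant_X_pow_sub_C_monomial hd hk, ha, monomial_pow, monomial_mul, ← hm,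
    ← C_1, ← C_neg, ← C_pow, coeff_C_mul, coeff_monomial, if_pos rfl]
  simp [hc]

theorem coeff_zero_eliminant_ne_zero [CharZero K] (hd : 0 < d₁) :
    coeff 0 (eliminant d₁ d₂ (X 1 ^ d₁ - 1 : MvPolynomial (Fin 2) K) (X 1 ^ d₂)) ≠ 0 := by
  have e : d₁ + d₂ - 1 = (d₁ - 1) + d₂ := by omega
  refine coeff_eliminant_ne_zero_of_monomial d₂ hd _ _ (fun _ => 0) _ (by simp) le_rfl 1 0 0
    (-d₁) (by simp [hd.ne']) (by simp) (by simp) (by simp) ?_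
  simp [e, pow_add, ← mul_assoc]
  ring

theorem coeff_single_one_eliminant_ne_zero [CharZero K] (hd : 0 < d₁) :
    coeff (Finsupp.single 1 (d₁ * (d₁ + d₂ - 1)))
      (eliminant d₁ d₂ (X 1 ^ d₁ - X 0 ^ d₁ : MvPolynomial (Fin 2) K) (X 1 ^ d₂)) ≠ 0 := by
  have e : d₁ + d₂ - 1 = (d₁ - 1) + d₂ := by omega
  refine coeff_eliminant_ne_zero_of_monomial d₂ hd _ _ ![0, X 1, 0] _ ?_ le_rfl (X 1 ^ d₁)
    (Finsupp.single 1 (d₁ * (d₁ + d₂ - 1))) 0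
    (-d₁) (by simp [hd.ne']) (by rw [← pow_mul, X_pow_eq_monomial]) (by simp) (by simp) ?_
  · intro i; fin_cases i <;> simp
  · simp [e, pow_add, ← mul_assoc]
    ring

theorem coeff_single_two_eliminant_ne_zero_of_le [CharZero K] (hd : 0 < d₁) :
    coeff (Finsupp.single 2 (d₁ + d₂ - 1))
      (eliminant d₁ d₂ (X 1 ^ d₁ : MvPolynomial (Fin 2) K) (X 1 ^ d₂)) ≠ 0 := by
  have e : d₁ + d₂ - 1 = (d₁ - 1) + d₂ := by omega
  refine coeff_eliminant_ne_zero_of_monomial d₂ hd _ _ ![0, 0, X 2] _ ?_ le_rfl (X 2)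
    (Finsupp.single 2 (d₁ + d₂ - 1)) 0
    (-d₁) (by simp [hd.ne']) (by simp [X_pow_eq_monomial]) (by simp) (by simp) ?_
  · intro i; fin_cases i <;> simp
  · simp [e, pow_add, ← mul_assoc]
    ring

theorem coeff_single_two_eliminant_ne_zero_of_lt (hd : 0 < d₁) :
    coeff (Finsupp.single 2 (2 * d₁ - 1))
      (eliminant d₁ d₂ (X 1 ^ d₁ + X 0 * X 1 ^ (d₁ - 1) : MvPolynomial (Fin 2) K) 0) ≠ 0 := by
  refine coeff_eliminant_ne_zero_of_monomial d₂ hd _ _ ![0, 0, X 2] _ ?_ (k := d₁ - 1) (by omega)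
    (X 2) (Finsupp.single 2 (d₁ - 1)) (Finsupp.single 2 1)
    (-1) (by simp) (by simp [X_pow_eq_monomial]) ?_ (by simp) ?_
  · intro i; fin_cases i <;> simp
  · rw [Finsupp.smul_single, ← Finsupp.single_add]
    congr 1
    simp
    omega
  · simp [← X.eq_1]
    ring

theorem coeff_mixed_eliminant_ne_zero [CharZero K] (hd : 0 < d₁) :
    coeff (Finsupp.single 1 (d₁ * (d₁ - 1)) + Finsupp.single 2 d₁)
      (eliminant d₁ d₂ (X 1 ^ d₁ + X 0 ^ d₁ : MvPolynomial (Fin 2) K) 0) ≠ 0 := by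
  refine coeff_eliminant_ne_zero_of_monomial d₂ hd _ _ ![0, X 1, X 2] _ ?_ (Nat.zero_le _)
    (X 2 - X 1 ^ d₁) 0 (Finsupp.single 1 (d₁ - 1) + Finsupp.single 2 1)
    (-d₁) (by simp [hd.ne']) (by simp)
    (by rw [smul_add, Finsupp.smul_single, Finsupp.smul_single, smul_eq_mul, smul_eq_mul,
      mul_one, add_zero]) (by simp; ring) ?_
  · intro i; fin_cases i <;> simp
  · have : (monomial (Finsupp.single 1 (d₁ - 1) + Finsupp.single 2 1) (-d₁ : K) :
      MvPolynomial (Fin 3) K) = -(X 2 * ((d₁ : MvPolynomial (Fin 3) K) * X 1 ^ (d₁ - 1))) := by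
      rw [← C_eq_coe_nat, X_pow_eq_monomial, X, C_mul_monomial, monomial_mul]
      simp [add_comm]
    rw [this]
    simp

theorem coeff_single_zero_eliminant_ne_zero (hd : 0 < d₁) :
    coeff (Finsupp.single 0 d₁)
      (eliminant d₁ d₂ (X 1 ^ d₁ : MvPolynomial (Fin 2) K) 0) ≠ 0 := by
  refine coeff_eliminant_ne_zero_of_monomial d₂ hd _ _ ![X 0, 0, 0] _ ?_ (Nat.zero_le _)
    0 0 (Finsupp.single 0 1) 1 (by simp) (by simp) (by simp) (by simp) ?_
  · intro i; fin_cases i <;> simp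
  · simp [← X.eq_1]

theorem resultant_derivative_ne_zero_of_eq [CharZero K] (hd : 0 < d₁) (f : Polynomial K) (u : K)
    (hu : u ≠ 0) (hf : f = Polynomial.C u * (Polynomial.X ^ d₁ - 1)) :
    Polynomial.resultant f (Polynomial.derivative f) d₁ (d₁ - 1) ≠ 0 := by
  have hder : Polynomial.derivative f =
      Polynomial.C (u * d₁) * Polynomial.X ^ (d₁ - 1) := by
    rw [hf, Polynomial.derivative_C_mul, Polynomial.derivative_sub, Polynomial.derivative_X_pow]
    simp [mul_assoc]
  rw [hder, hf, Polynomial.resultant_C_mul_left, ← Polynomial.C_1,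
    Polynomial.resultant_X_pow_sub_C_monomial hd le_rfl]
  simp [hu, hd.ne']

theorem resultant_derivative_eliminantLine_ne_zero [CharZero K] (hd : 0 < d₁) :
    Polynomial.resultant
      (eliminantLine d₁ d₂ (X 1 ^ d₁ + X 0 * X 1 ^ min 1 (d₁ - 1) : MvPolynomial (Fin 2) K) 0)
      (Polynomial.derivative (eliminantLine d₁ d₂
        (X 1 ^ d₁ + X 0 * X 1 ^ min 1 (d₁ - 1) : MvPolynomial (Fin 2) K) 0)) d₁ (d₁ - 1) ≠ 0 := by
  have hline : ∃ u : K, u ≠ 0 ∧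
      eliminantLine d₁ d₂ (X 1 ^ d₁ + X 0 * X 1 ^ min 1 (d₁ - 1) : MvPolynomial (Fin 2) K) 0 =
        Polynomial.C u * (Polynomial.X ^ d₁ - 1) := by
    have hvel : aeval ![Polynomial.C ((![Polynomial.X, 0, 1] : Fin 3 → Polynomial K) 1),
          Polynomial.X] (X 1 ^ d₁ + X 0 * X 1 ^ min 1 (d₁ - 1) : MvPolynomial (Fin 2) K) -
        Polynomial.C ((![Polynomial.X, 0, 1] : Fin 3 → Polynomial K) 2) =
        Polynomial.X ^ d₁ - Polynomial.C 1 := by simp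
    have hdeg : (Polynomial.X ^ d₁ - Polynomial.C (1 : Polynomial K)).natDegree ≤ d₁ :=
      Polynomial.natDegree_sub_C.le.trans (Polynomial.natDegree_X_pow_le _)
    have hlc : (Polynomial.X ^ d₁ - Polynomial.C (1 : Polynomial K)).coeff d₁ = 1 := by
      simp [Polynomial.coeff_one, hd.ne']
    have hacc : Polynomial.C ((![Polynomial.X, 0, 1] : Fin 3 → Polynomial K) 0) -
        Polynomial.C ((![Polynomial.X, 0, 1] : Fin 3 → Polynomial K) 2) *
          aeval ![Polynomial.C ((![Polynomial.X, 0, 1] : Fin 3 → Polynomial K) 1), Polynomial.X]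
            (pderiv 0 (X 1 ^ d₁ + X 0 * X 1 ^ min 1 (d₁ - 1) : MvPolynomial (Fin 2) K)) -
        aeval ![Polynomial.C ((![Polynomial.X, 0, 1] : Fin 3 → Polynomial K) 1), Polynomial.X]
            (pderiv 1 (X 1 ^ d₁ + X 0 * X 1 ^ min 1 (d₁ - 1) : MvPolynomial (Fin 2) K)) *
          aeval ![Polynomial.C ((![Polynomial.X, 0, 1] : Fin 3 → Polynomial K) 1), Polynomial.X]
            (0 : MvPolynomial (Fin 2) K) =
        Polynomial.C Polynomial.X - Polynomial.X ^ min 1 (d₁ - 1) := by simp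
    rw [eliminantLine, aeval_eliminant_eq_resultant, hvel, hacc]
    obtain rfl | hd' := Nat.eq_or_lt_of_le (Nat.succ_le_of_lt hd)
    · refine ⟨1, one_ne_zero, ?_⟩
      rw [show (Polynomial.C Polynomial.X - Polynomial.X ^ min 1 (Nat.succ 0 - 1) :
        Polynomial (Polynomial K)) = Polynomial.C (Polynomial.X - 1) by simp,
        Polynomial.resultant_C_right, hlc]
      simp
    · have hneg : (Polynomial.C Polynomial.X - Polynomial.X ^ 1 : Polynomial (Polynomial K)) =
          Polynomial.C (-1) * (Polynomial.X - Polynomial.C Polynomial.X) := by simp; ring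
      refine ⟨(-1) ^ d₁ * (-1) ^ d₁, by simp, ?_⟩
      rw [min_eq_left (by omega), show d₁ + d₂ - 1 = 1 + (d₁ + d₂ - 2) by omega, hneg,
        Polynomial.resultant_C_mul_right, Polynomial.resultant_add_right_deg _ _ _ _ _ (by simp),
        Polynomial.resultant_X_sub_C_right _ _ _ hdeg, hlc]
      simp [mul_assoc]
  obtain ⟨u, hu, h⟩ := hline
  exact resultant_derivative_ne_zero_of_eq hd _ u hu h

end Examples

theorem map_eliminantLine {A B : Type*} [CommRing A] [CommRing B] (φ : A →+* B) (d₁ d₂ : ℕ)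
    (g₁ g₂ : MvPolynomial (Fin 2) A) :
    (eliminantLine d₁ d₂ g₁ g₂).map φ =
      eliminantLine d₁ d₂ (MvPolynomial.map φ g₁) (MvPolynomial.map φ g₂) := by
  rw [eliminantLine, eliminantLine, ← map_eliminant]
  generalize eliminant d₁ d₂ g₁ g₂ = F
  induction F using MvPolynomial.induction_on with
  | C a => simp
  | add p q hp hq => simp [hp, hq]
  | mul_X p i hp =>
    rw [map_mul, Polynomial.map_mul, hp, map_mul, map_mul]
    congr 1
    fin_cases i <;> simp

/-- The exponents of the monomials of degree at most `d` in two variables. -/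
def exponentsLE (d : ℕ) : Finset (Fin 2 →₀ ℕ) :=
  (Finset.range (d + 1)).biUnion fun k => Finset.univ.finsuppAntidiag k

theorem mem_exponentsLE {d : ℕ} {m : Fin 2 →₀ ℕ} : m ∈ exponentsLE d ↔ m 0 + m 1 ≤ d := by
  simp [exponentsLE, Finset.mem_finsuppAntidiag]

theorem map_sum_monomial_exponentsLE {A K : Type*} [CommRing A] [CommRing K] (φ : A →+* K) {d : ℕ}
    (c : exponentsLE d → A) (g : MvPolynomial (Fin 2) K) (hg : ∀ m ∈ g.support, m 0 + m 1 ≤ d)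
    (hc : ∀ m, φ (c m) = g.coeff m) :
    MvPolynomial.map φ (∑ m : exponentsLE d, monomial m.1 (c m)) = g := by
  simp only [map_sum, map_monomial, hc]
  rw [Finset.sum_coe_sort (exponentsLE d) (fun m => monomial m (g.coeff m))]
  conv_rhs => rw [g.as_sum]
  refine (Finset.sum_subset (fun m hm => mem_exponentsLE.2 (hg m hm)) fun m _ hm => ?_).symm
  rw [notMem_support_iff.1 hm, monomial_zero]

section Generic

universe u

/-- `p` holds for all pairs of polynomials of degree at most `d₁`, `d₂` in a nonempty Zariski open
set. -/
def HoldsGenerically (K : Type u) [Field K] (d₁ d₂ : ℕ)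
    (p : MvPolynomial (Fin 2) K → MvPolynomial (Fin 2) K → Prop) : Prop :=
  ∃ P : MvPolynomial ((Fin 2 →₀ ℕ) ⊕ (Fin 2 →₀ ℕ)) K, P ≠ 0 ∧
    (∀ m : Fin 2 →₀ ℕ,
      (Sum.inl m ∈ P.vars → m 0 + m 1 ≤ d₁) ∧ (Sum.inr m ∈ P.vars → m 0 + m 1 ≤ d₂)) ∧
    ∀ g₁ g₂ : MvPolynomial (Fin 2) K, (∀ m ∈ g₁.support, m 0 + m 1 ≤ d₁) →
      (∀ m ∈ g₂.support, m 0 + m 1 ≤ d₂) →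
      MvPolynomial.eval (Sum.elim (fun m => MvPolynomial.coeff m g₁)
        (fun m => MvPolynomial.coeff m g₂)) P ≠ 0 → p g₁ g₂

variable {K : Type u} [Field K] {d₁ d₂ : ℕ}

theorem HoldsGenerically.and {p q : MvPolynomial (Fin 2) K → MvPolynomial (Fin 2) K → Prop}
    (hp : HoldsGenerically K d₁ d₂ p) (hq : HoldsGenerically K d₁ d₂ q) :
    HoldsGenerically K d₁ d₂ fun g₁ g₂ => p g₁ g₂ ∧ q g₁ g₂ := by
  classical
  obtain ⟨P, hP, hPv, hPe⟩ := hp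
  obtain ⟨Q, hQ, hQv, hQe⟩ := hq
  refine ⟨P * Q, mul_ne_zero hP hQ, fun m => ⟨fun hm => ?_, fun hm => ?_⟩,
    fun g₁ g₂ h₁ h₂ he => ?_⟩
  · exact (Finset.mem_union.1 (vars_mul P Q hm)).elim (hPv m).1 (hQv m).1
  · exact (Finset.mem_union.1 (vars_mul P Q hm)).elim (hPv m).2 (hQv m).2
  · rw [map_mul] at he
    exact ⟨hPe g₁ g₂ h₁ h₂ (left_ne_zero_of_mul he), hQe g₁ g₂ h₁ h₂ (right_ne_zero_of_mul he)⟩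

/-- A quantity attached to two polynomials that commutes with ring homomorphisms is generically
nonzero as soon as it is nonzero once. -/
theorem HoldsGenerically.of_natural
    (c : ∀ (A : Type u) [CommRing A], MvPolynomial (Fin 2) A → MvPolynomial (Fin 2) A → A)
    (hc : ∀ (A : Type u) [CommRing A] (φ : A →+* K) (g₁ g₂ : MvPolynomial (Fin 2) A),
      φ (c A g₁ g₂) = c K (MvPolynomial.map φ g₁) (MvPolynomial.map φ g₂))
    (g₁ g₂ : MvPolynomial (Fin 2) K) (h₁ : ∀ m ∈ g₁.support, m 0 + m 1 ≤ d₁)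
    (h₂ : ∀ m ∈ g₂.support, m 0 + m 1 ≤ d₂) (hne : c K g₁ g₂ ≠ 0) :
    HoldsGenerically K d₁ d₂ fun g₁ g₂ => c K g₁ g₂ ≠ 0 := by
  classical
  set σ : exponentsLE d₁ ⊕ exponentsLE d₂ → (Fin 2 →₀ ℕ) ⊕ (Fin 2 →₀ ℕ) :=
    Sum.map Subtype.val Subtype.val with hσ
  set Q : MvPolynomial (exponentsLE d₁ ⊕ exponentsLE d₂) K :=
    c _ (∑ m : exponentsLE d₁, monomial m.1 (X (Sum.inl m)))
      (∑ m : exponentsLE d₂, monomial m.1 (X (Sum.inr m))) with hQ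
  have heval : ∀ g₁ g₂ : MvPolynomial (Fin 2) K, (∀ m ∈ g₁.support, m 0 + m 1 ≤ d₁) →
      (∀ m ∈ g₂.support, m 0 + m 1 ≤ d₂) →
      MvPolynomial.eval (Sum.elim (fun m => MvPolynomial.coeff m g₁)
        (fun m => MvPolynomial.coeff m g₂)) (rename σ Q) = c K g₁ g₂ := by
    intro g₁ g₂ h₁ h₂
    rw [eval_rename, hQ, hc, map_sum_monomial_exponentsLE _ _ g₁ h₁ (by simp [hσ]),
      map_sum_monomial_exponentsLE _ _ g₂ h₂ (by simp [hσ])]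
  refine ⟨rename σ Q, fun h0 => hne (by rw [← heval g₁ g₂ h₁ h₂, h0, map_zero]),
    fun m => ⟨fun hm => ?_, fun hm => ?_⟩, fun g₁ g₂ h₁ h₂ he => by rwa [heval g₁ g₂ h₁ h₂] at he⟩
  all_goals
    obtain ⟨s, -, hs⟩ := Finset.mem_image.1 (vars_rename σ Q hm)
    rcases s with s | s <;> simp [hσ] at hs
    rw [← hs]
    exact mem_exponentsLE.1 s.2

theorem HoldsGenerically.mono {p q : MvPolynomial (Fin 2) K → MvPolynomial (Fin 2) K → Prop}
    (hp : HoldsGenerically K d₁ d₂ p) (h : ∀ g₁ g₂, p g₁ g₂ → q g₁ g₂) :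
    HoldsGenerically K d₁ d₂ q := by
  obtain ⟨P, hP, hPv, hPe⟩ := hp
  exact ⟨P, hP, hPv, fun g₁ g₂ h₁ h₂ he => h g₁ g₂ (hPe g₁ g₂ h₁ h₂ he)⟩

theorem degree_le_of_totalDegree_le {A : Type*} [CommRing A] {g : MvPolynomial (Fin 2) A} {d : ℕ}
    (h : g.totalDegree ≤ d) : ∀ m ∈ g.support, m 0 + m 1 ≤ d := by
  intro m hm
  have := (le_totalDegree hm).trans h
  rwa [Finsupp.sum_fintype _ _ (by simp), Fin.sum_univ_two] at this

theorem HoldsGenerically.coeff_eliminant (m : Fin 3 →₀ ℕ) (g₁ g₂ : MvPolynomial (Fin 2) K)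
    (h₁ : g₁.totalDegree ≤ d₁) (h₂ : g₂.totalDegree ≤ d₂)
    (hne : coeff m (eliminant d₁ d₂ g₁ g₂) ≠ 0) :
    HoldsGenerically K d₁ d₂ fun g₁ g₂ => coeff m (eliminant d₁ d₂ g₁ g₂) ≠ 0 :=
  .of_natural (fun A _ g₁ g₂ => coeff m (eliminant d₁ d₂ g₁ g₂))
    (fun A _ φ g₁ g₂ => by rw [← map_eliminant, coeff_map]) g₁ g₂
    (degree_le_of_totalDegree_le h₁) (degree_le_of_totalDegree_le h₂) hne

/-- The conditions on the right-hand sides under which the eliminant is the minimal polynomial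
and has the largest possible Newton polytope. -/
structure IsGeneric (d₁ d₂ : ℕ) (g₁ g₂ : MvPolynomial (Fin 2) K) : Prop where
  coeff_ne_zero : g₁.coeff (Finsupp.single 1 d₁) ≠ 0
  separable : Polynomial.resultant (eliminantLine d₁ d₂ g₁ g₂)
    (Polynomial.derivative (eliminantLine d₁ d₂ g₁ g₂)) d₁ (d₁ - 1) ≠ 0
  coeff_zero : coeff 0 (eliminant d₁ d₂ g₁ g₂) ≠ 0
  coeff_single_zero : coeff (Finsupp.single 0 d₁) (eliminant d₁ d₂ g₁ g₂) ≠ 0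
  coeff_single_one : coeff (Finsupp.single 1 (d₁ * (d₁ + d₂ - 1))) (eliminant d₁ d₂ g₁ g₂) ≠ 0
  coeff_single_two_of_le : d₁ ≤ d₂ →
    coeff (Finsupp.single 2 (d₁ + d₂ - 1)) (eliminant d₁ d₂ g₁ g₂) ≠ 0
  coeff_single_two_of_lt : d₂ < d₁ →
    coeff (Finsupp.single 2 (2 * d₁ - 1)) (eliminant d₁ d₂ g₁ g₂) ≠ 0
  coeff_mixed : d₂ < d₁ →
    coeff (Finsupp.single 1 (d₁ * (d₁ - 1)) + Finsupp.single 2 d₁) (eliminant d₁ d₂ g₁ g₂) ≠ 0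

theorem holdsGenerically_isGeneric [CharZero K] (hd : 0 < d₁) :
    HoldsGenerically K d₁ d₂ (IsGeneric d₁ d₂) := by
  have hX : ∀ (i : Fin 2) (n : ℕ), (X i ^ n : MvPolynomial (Fin 2) K).totalDegree ≤ n :=
    fun i n => (totalDegree_X_pow i n).le
  have hmin : (X 0 * X 1 ^ min 1 (d₁ - 1) : MvPolynomial (Fin 2) K).totalDegree ≤ d₁ := by
    refine (totalDegree_mul _ _).trans ?_
    have := hX 1 (min 1 (d₁ - 1))
    rw [totalDegree_X]
    omega
  have hpred : (X 0 * X 1 ^ (d₁ - 1) : MvPolynomial (Fin 2) K).totalDegree ≤ d₁ := by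
    refine (totalDegree_mul _ _).trans ?_
    have := hX 1 (d₁ - 1)
    rw [totalDegree_X]
    omega
  have h1 : HoldsGenerically K d₁ d₂ fun g₁ _ => g₁.coeff (Finsupp.single 1 d₁) ≠ 0 :=
    .of_natural (fun A _ g₁ _ => g₁.coeff (Finsupp.single 1 d₁))
      (fun A _ φ g₁ _ => (coeff_map φ g₁ _).symm)
      (X 1 ^ d₁) 0 (degree_le_of_totalDegree_le (hX 1 d₁)) (by simp) (by simp [X_pow_eq_monomial])
  have h2 := HoldsGenerically.of_natural (K := K) (d₁ := d₁) (d₂ := d₂)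
    (fun A _ g₁ g₂ => Polynomial.resultant (eliminantLine d₁ d₂ g₁ g₂)
      (Polynomial.derivative (eliminantLine d₁ d₂ g₁ g₂)) d₁ (d₁ - 1))
    (fun A _ φ g₁ g₂ => by
      rw [← Polynomial.resultant_map_map, ← Polynomial.derivative_map, map_eliminantLine]) _ _
    (degree_le_of_totalDegree_le ((totalDegree_add _ _).trans (max_le (hX 1 d₁) hmin)))
    (by simp) (resultant_derivative_eliminantLine_ne_zero d₂ hd)
  have h3 := HoldsGenerically.coeff_eliminant (K := K) 0 _ _
    ((totalDegree_sub _ _).trans (max_le (hX 1 d₁) (by simp))) (hX 1 d₂)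
    (coeff_zero_eliminant_ne_zero d₂ hd)
  have h4 := HoldsGenerically.coeff_eliminant (K := K) (d₂ := d₂) _ _ _
    (hX 1 d₁) (by simp) (coeff_single_zero_eliminant_ne_zero d₂ hd)
  have h5 := HoldsGenerically.coeff_eliminant (K := K) _ _ _
    ((totalDegree_sub _ _).trans (max_le (hX 1 d₁) (hX 0 d₁))) (hX 1 d₂)
    (coeff_single_one_eliminant_ne_zero d₂ hd)
  have h6 := HoldsGenerically.coeff_eliminant (K := K) _ _ _
    (hX 1 d₁) (hX 1 d₂) (coeff_single_two_eliminant_ne_zero_of_le d₂ hd)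
  have h7 := HoldsGenerically.coeff_eliminant (K := K) (d₂ := d₂) _ _ _
    ((totalDegree_add _ _).trans (max_le (hX 1 d₁) hpred)) (by simp)
    (coeff_single_two_eliminant_ne_zero_of_lt d₂ hd)
  have h8 := HoldsGenerically.coeff_eliminant (K := K) (d₂ := d₂) _ _ _
    ((totalDegree_add _ _).trans (max_le (hX 1 d₁) (hX 0 d₁))) (by simp)
    (coeff_mixed_eliminant_ne_zero d₂ hd)
  have hbase := ((((h1.and h2).and h3).and h4).and h5)
  obtain hle | hlt := le_or_gt d₁ d₂
  · refine (hbase.and h6).mono fun g₁ g₂ h => ?_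
    obtain ⟨⟨⟨⟨⟨h1, h2⟩, h3⟩, h4⟩, h5⟩, h6⟩ := h
    exact ⟨h1, h2, h3, h4, h5, fun _ => h6, fun h => absurd hle h.not_ge,
      fun h => absurd hle h.not_ge⟩
  · refine ((hbase.and h7).and h8).mono fun g₁ g₂ h => ?_
    obtain ⟨⟨⟨⟨⟨⟨h1, h2⟩, h3⟩, h4⟩, h5⟩, h7⟩, h8⟩ := h
    exact ⟨h1, h2, h3, h4, h5, fun h => absurd hlt h.not_gt, fun _ => h7, fun _ => h8⟩

end Generic

theorem Convex.combination_mem {E : Type*} [AddCommGroup E] [Module ℝ E] {s : Set E}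
    (hs : Convex ℝ s) {u v w : E} (h0 : (0 : E) ∈ s) (hu : u ∈ s) (hv : v ∈ s) (hw : w ∈ s)
    {a b c : ℝ} (ha : 0 ≤ a) (hb : 0 ≤ b) (hc : 0 ≤ c) (habc : a + b + c ≤ 1) :
    a • u + b • v + c • w ∈ s := by
  have := hs.sum_mem (t := Finset.univ) (w := ![a, b, c, 1 - (a + b + c)]) (z := ![u, v, w, 0])
    (by intro i _; fin_cases i <;> simp <;> linarith) (by simp [Fin.sum_univ_four])
    (by intro i _; fin_cases i <;> simpa)
  simpa [Fin.sum_univ_four] using this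

theorem convexHull_eq_simplex {S : Set (Fin 3 → ℝ)} {n N : ℝ} (hn : 0 < n) (hN : 0 < N)
    (hS : ∀ e ∈ S, (∀ k, 0 ≤ e k) ∧ e 0 + n * e 1 + N * e 2 ≤ n * N)
    (h0 : 0 ∈ S) (h1 : ![n * N, 0, 0] ∈ S) (h2 : ![0, N, 0] ∈ S) (h3 : ![0, 0, n] ∈ S) :
    convexHull ℝ S = {e | (∀ k, 0 ≤ e k) ∧ e 0 + n * e 1 + N * e 2 ≤ n * N} := by
  refine subset_antisymm (convexHull_min hS ?_) fun e he => ?_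
  · intro x hx y hy a b ha hb hab
    refine ⟨fun k => add_nonneg (mul_nonneg ha (hx.1 k)) (mul_nonneg hb (hy.1 k)), ?_⟩
    have hx' := mul_le_mul_of_nonneg_left hx.2 ha
    have hy' := mul_le_mul_of_nonneg_left hy.2 hb
    have : a * (n * N) + b * (n * N) = n * N := by rw [← add_mul, hab, one_mul]
    simp only [Pi.add_apply, Pi.smul_apply, smul_eq_mul]
    linarith
  · have hsub := subset_convexHull ℝ S
    have := (convex_convexHull ℝ S).combination_mem (hsub h0) (hsub h1) (hsub h2) (hsub h3)
      (a := e 0 / (n * N)) (b := e 1 / N) (c := e 2 / n)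
      (div_nonneg (he.1 0) (by positivity)) (div_nonneg (he.1 1) hN.le) (div_nonneg (he.1 2) hn.le)
      (by
        have h := he.2
        rw [show e 0 / (n * N) + e 1 / N + e 2 / n = (e 0 + n * e 1 + N * e 2) / (n * N) by
          field_simp]
        exact (div_le_one (by positivity)).2 h)
    convert this using 1
    ext k
    fin_cases k <;> simp <;> field_simp

theorem convexHull_eq_truncated_simplex {S : Set (Fin 3 → ℝ)} {n d : ℝ} (hn : 1 < n) (hd : 0 < d)
    (hS : ∀ e ∈ S, (∀ k, 0 ≤ e k) ∧ e 0 + n * e 1 + (2 * n - 1) * e 2 ≤ n * (2 * n - 1) ∧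
      e 0 + d * e 1 + (n + d - 1) * e 2 ≤ n * (n + d - 1))
    (h0 : 0 ∈ S) (h1 : ![n * (n + d - 1), 0, 0] ∈ S) (h2 : ![0, 2 * n - 1, 0] ∈ S)
    (h3 : ![0, 0, n] ∈ S) (h4 : ![n * (n - 1), n, 0] ∈ S) :
    convexHull ℝ S = {e | (∀ k, 0 ≤ e k) ∧
      e 0 + n * e 1 + (2 * n - 1) * e 2 ≤ n * (2 * n - 1) ∧
      e 0 + d * e 1 + (n + d - 1) * e 2 ≤ n * (n + d - 1)} := by
  have hn0 : 0 < n := by linarith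
  have hn1 : 0 < n - 1 := by linarith
  have hN : 0 < n + d - 1 := by linarith
  have hM : 0 < 2 * n - 1 := by linarith
  refine subset_antisymm (convexHull_min hS ?_) fun e he => ?_
  · intro x hx y hy a b ha hb hab
    refine ⟨fun k => add_nonneg (mul_nonneg ha (hx.1 k)) (mul_nonneg hb (hy.1 k)), ?_, ?_⟩
    · have hx' := mul_le_mul_of_nonneg_left hx.2.1 ha
      have hy' := mul_le_mul_of_nonneg_left hy.2.1 hb
      have : a * (n * (2 * n - 1)) + b * (n * (2 * n - 1)) = n * (2 * n - 1) := by
        rw [← add_mul, hab, one_mul]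
      simp only [Pi.add_apply, Pi.smul_apply, smul_eq_mul]
      linarith
    · have hx' := mul_le_mul_of_nonneg_left hx.2.2 ha
      have hy' := mul_le_mul_of_nonneg_left hy.2.2 hb
      have : a * (n * (n + d - 1)) + b * (n * (n + d - 1)) = n * (n + d - 1) := by
        rw [← add_mul, hab, one_mul]
      simp only [Pi.add_apply, Pi.smul_apply, smul_eq_mul]
      linarith
  · have hsub := subset_convexHull ℝ S
    have he0 := he.1 0
    have he1 := he.1 1
    have he2 := he.1 2
    rcases le_total (e 1 * (n - 1)) (e 0) with h | h
    · have := (convex_convexHull ℝ S).combination_mem (hsub h0) (hsub h1) (hsub h4) (hsub h3)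
        (a := (e 0 - e 1 * (n - 1)) / (n * (n + d - 1))) (b := e 1 / n) (c := e 2 / n)
        (div_nonneg (by linarith) (by positivity)) (by positivity) (by positivity)
        (by
          have h := he.2.2
          rw [show (e 0 - e 1 * (n - 1)) / (n * (n + d - 1)) + e 1 / n + e 2 / n =
            (e 0 + d * e 1 + (n + d - 1) * e 2) / (n * (n + d - 1)) by
            field_simp; ring]
          exact (div_le_one (by positivity)).2 h)
      convert this using 1
      ext k
      fin_cases k <;> simp <;> field_simp
      ring
    · generalize hMn : 2 * n - 1 = M at *
      have := (convex_convexHull ℝ S).combination_mem (hsub h0) (hsub h2) (hsub h4) (hsub h3)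
        (a := (e 1 * (n - 1) - e 0) / ((n - 1) * M)) (b := e 0 / (n * (n - 1)))
        (c := e 2 / n)
        (div_nonneg (by linarith) (by positivity)) (by positivity) (by positivity)
        (by
          have h := he.2.1
          rw [show (e 1 * (n - 1) - e 0) / ((n - 1) * M) + e 0 / (n * (n - 1)) + e 2 / n =
            (e 0 + n * e 1 + M * e 2) / (n * M) by
            field_simp; rw [← hMn]; ring]
          exact (div_le_one (by positivity)).2 h)
      convert this using 1
      ext k
      fin_cases k <;> simp <;> field_simp
      ring

section Elimination

variable {K : Type*} [CommRing K]

/-- The Lie derivative along the vector field `g`. -/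
def lieDer {n : ℕ} (g : Fin n → MvPolynomial (Fin n) K) :
    Derivation K (MvPolynomial (Fin n) K) (MvPolynomial (Fin n) K) :=
  mkDerivation K g

/-- The homomorphism substituting the iterated Lie derivatives of `x_i` for `x_i^{(j)}`. -/
def solutionHom {n : ℕ} (g : Fin n → MvPolynomial (Fin n) K) :
    MvPolynomial (Fin n × ℕ) K →ₐ[K] MvPolynomial (Fin n) K :=
  aeval fun v => (⇑(lieDer g))^[v.2] (X v.1)

variable {n : ℕ} (g : Fin n → MvPolynomial (Fin n) K)

theorem solutionHom_rename (q : MvPolynomial (Fin n) K) :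
    solutionHom g (rename (fun j => (j, 0)) q) = q := by
  rw [solutionHom, aeval_rename]
  simp [Function.comp_def]

theorem solutionHom_diffDer (p : MvPolynomial (Fin n × ℕ) K) :
    solutionHom g (diffDer K n p) = lieDer g (solutionHom g p) := by
  induction p using MvPolynomial.induction_on with
  | C a => simp [solutionHom, diffDer, lieDer]
  | add p q hp hq => simp [hp, hq]
  | mul_X p i hp =>
    have hX : solutionHom g (diffDer K n (X i)) = lieDer g (solutionHom g (X i)) := by
      simp [solutionHom, diffDer, Function.iterate_succ_apply']
    simp only [Derivation.leibniz, map_add, map_mul, smul_eq_mul, hp, hX]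

theorem sysIdeal_le_ker : sysIdeal K n g ≤ RingHom.ker (solutionHom g) := by
  refine Ideal.span_le.2 ?_
  rintro _ ⟨_, ⟨i, rfl⟩, j, rfl⟩
  rw [SetLike.mem_coe, RingHom.mem_ker]
  induction j with
  | zero =>
    rw [Function.iterate_zero_apply, map_sub, solutionHom_rename]
    simp [solutionHom, lieDer]
  | succ j ih => rw [Function.iterate_succ_apply', solutionHom_diffDer, ih, map_zero]

theorem diffDer_mem_sysIdeal {p : MvPolynomial (Fin n × ℕ) K} (hp : p ∈ sysIdeal K n g) :
    diffDer K n p ∈ sysIdeal K n g := by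
  refine Submodule.span_induction (p := fun p _ => diffDer K n p ∈ sysIdeal K n g) ?_ ?_ ?_ ?_ hp
  · rintro _ ⟨f, hf, j, rfl⟩
    exact Ideal.subset_span ⟨f, hf, j + 1, (Function.iterate_succ_apply' _ _ _).symm⟩
  · simp
  · intro p q _ _ hp hq
    rw [map_add]
    exact Ideal.add_mem _ hp hq
  · intro a p hpm hp
    rw [smul_eq_mul, Derivation.leibniz, smul_eq_mul, smul_eq_mul]
    exact Ideal.add_mem _ (Ideal.mul_mem_left _ _ hp) (Ideal.mul_mem_right _ _ hpm)

theorem diffDer_rename_sub_mem (q : MvPolynomial (Fin n) K) :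
    diffDer K n (rename (fun j => (j, 0)) q) - rename (fun j => (j, 0)) (lieDer g q) ∈
      sysIdeal K n g := by
  induction q using MvPolynomial.induction_on with
  | C a => simp [diffDer, lieDer]
  | add p q hp hq =>
    convert Ideal.add_mem _ hp hq using 1
    simp only [map_add]
    ring
  | mul_X p i hp =>
    have hX : diffDer K n (rename (fun j => (j, 0)) (X i)) -
        rename (fun j => (j, 0)) (lieDer g (X i)) ∈ sysIdeal K n g := by
      refine Ideal.subset_span ⟨_, ⟨i, rfl⟩, 0, ?_⟩
      simp [diffDer, lieDer]
    convert Ideal.add_mem _ (Ideal.mul_mem_left _ (rename (fun j => (j, 0)) p) hX)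
      (Ideal.mul_mem_left _ (rename (fun j => (j, 0)) (X i)) hp) using 1
    simp only [map_add, map_mul, Derivation.leibniz, smul_eq_mul]
    ring

theorem sub_rename_solutionHom_mem (p : MvPolynomial (Fin n × ℕ) K) :
    p - rename (fun j => (j, 0)) (solutionHom g p) ∈ sysIdeal K n g := by
  induction p using MvPolynomial.induction_on with
  | C a => simp [solutionHom, algebraMap_eq]
  | add p q hp hq =>
    convert Ideal.add_mem _ hp hq using 1
    simp only [map_add]
    ring
  | mul_X p i hp =>
    have hX : (X i - rename (fun j => (j, 0)) (solutionHom g (X i)) :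
        MvPolynomial (Fin n × ℕ) K) ∈ sysIdeal K n g := by
      obtain ⟨i, j⟩ := i
      induction j with
      | zero => simp [solutionHom]
      | succ j ih =>
        have h₁ := diffDer_mem_sysIdeal g ih
        have h₂ := diffDer_rename_sub_mem g (solutionHom g (X (i, j)))
        have h₃ : diffDer K n (X (i, j)) = X (i, j + 1) := by simp [diffDer]
        rw [← solutionHom_diffDer, h₃] at h₂
        convert Ideal.add_mem _ h₁ h₂ using 1
        rw [map_sub, h₃]
        ring
    convert Ideal.add_mem _ (Ideal.mul_mem_left _ p hX)
      (Ideal.mul_mem_left _ (rename (fun j => (j, 0)) (solutionHom g (X i))) hp) using 1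
    simp only [map_mul]
    ring

theorem mem_sysIdeal {p : MvPolynomial (Fin n × ℕ) K} :
    p ∈ sysIdeal K n g ↔ solutionHom g p = 0 := by
  refine ⟨fun hp => sysIdeal_le_ker g hp, fun hp => ?_⟩
  simpa [hp] using sub_rename_solutionHom_mem g p

end Elimination

/-- The variables `x₁'', x₁, x₁'` of the eliminant, as differential variables. -/
def jetVar : Fin 3 → Fin 2 × ℕ := ![(0, 2), (0, 0), (0, 1)]

theorem jetVar_injective : Function.Injective jetVar := by
  intro i j h
  fin_cases i <;> fin_cases j <;> simp_all [jetVar]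

section

variable {K : Type*} [Field K]

theorem expVecs_rename_jetVar (F : MvPolynomial (Fin 3) K) :
    expVecs K 2 2 (rename jetVar F) =
      (fun m : Fin 3 →₀ ℕ => (![m 1, m 2, m 0] : Fin 3 → ℝ)) '' F.support := by
  classical
  have hvec : ∀ m : Fin 3 →₀ ℕ, (fun k : Fin 3 =>
      ((m.mapDomain jetVar) ((0 : Fin 2), (k : ℕ)) : ℝ)) = ![(m 1 : ℝ), m 2, m 0] := by
    intro m
    ext k
    have h := fun i => Finsupp.mapDomain_apply jetVar_injective m i
    fin_cases k
    · exact congrArg _ (h 1)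
    · exact congrArg _ (h 2)
    · exact congrArg _ (h 0)
  ext e
  rw [expVecs, support_rename_of_injective jetVar_injective]
  constructor
  · rintro ⟨_, hs, rfl⟩
    obtain ⟨m, hm, rfl⟩ := Finset.mem_image.1 (Finset.mem_coe.1 hs)
    exact ⟨m, hm, (hvec m).symm⟩
  · rintro ⟨m, hm, rfl⟩
    exact ⟨_, Finset.mem_image_of_mem _ hm, (hvec m).symm⟩

variable {d₁ d₂ : ℕ} {g₁ g₂ : MvPolynomial (Fin 2) K}

theorem newtonPolytope_eliminant_of_le (hd₁ : 0 < d₁) (hle : d₁ ≤ d₂)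
    (h₁ : ∀ m ∈ g₁.support, m 0 + m 1 ≤ d₁) (h₂ : ∀ m ∈ g₂.support, m 0 + m 1 ≤ d₂)
    (h : IsGeneric d₁ d₂ g₁ g₂) :
    newtonPolytope K 2 2 (rename jetVar (eliminant d₁ d₂ g₁ g₂)) =
      {e : Fin 3 → ℝ | (∀ k, 0 ≤ e k) ∧
        e 0 + (d₁ : ℝ) * e 1 + ((d₁ + d₂ - 1 : ℕ) : ℝ) * e 2 ≤
          ((d₁ * (d₁ + d₂ - 1) : ℕ) : ℝ)} := by
  rw [newtonPolytope, expVecs_rename_jetVar, Nat.cast_mul]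
  refine convexHull_eq_simplex (by exact_mod_cast hd₁)
    (by exact_mod_cast (by omega : 0 < d₁ + d₂ - 1)) ?_ ?_ ?_ ?_ ?_
  · rintro _ ⟨m, hm, rfl⟩
    have hb := weight_bound_eliminant (d₁ := d₁) (d₂ := d₂) (N := d₁ + d₂ - 1) (k := d₁) hd₁ le_rfl
      (by omega) le_rfl h₁ h₂ hm
    refine ⟨fun k => by fin_cases k <;> simp, ?_⟩
    rw [← Nat.cast_mul]
    simp only [Matrix.cons_val]
    norm_cast
    linarith
  · exact ⟨0, mem_support_iff.2 h.coeff_zero, by ext k; fin_cases k <;> simp⟩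
  · exact ⟨_, mem_support_iff.2 h.coeff_single_one, by ext k; fin_cases k <;> simp⟩
  · exact ⟨_, mem_support_iff.2 (h.coeff_single_two_of_le hle), by ext k; fin_cases k <;> simp⟩
  · exact ⟨_, mem_support_iff.2 h.coeff_single_zero, by ext k; fin_cases k <;> simp⟩

theorem newtonPolytope_eliminant_of_lt (hd₂ : 0 < d₂) (hlt : d₂ < d₁)
    (h₁ : ∀ m ∈ g₁.support, m 0 + m 1 ≤ d₁) (h₂ : ∀ m ∈ g₂.support, m 0 + m 1 ≤ d₂)
    (h : IsGeneric d₁ d₂ g₁ g₂) :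
    newtonPolytope K 2 2 (rename jetVar (eliminant d₁ d₂ g₁ g₂)) =
      {e : Fin 3 → ℝ | (∀ k, 0 ≤ e k) ∧
        e 0 + (d₁ : ℝ) * e 1 + ((2 * d₁ - 1 : ℕ) : ℝ) * e 2 ≤ ((d₁ * (2 * d₁ - 1) : ℕ) : ℝ) ∧
        e 0 + (d₂ : ℝ) * e 1 + ((d₁ + d₂ - 1 : ℕ) : ℝ) * e 2 ≤
          ((d₁ * (d₁ + d₂ - 1) : ℕ) : ℝ)} := by
  have hd₁ : 0 < d₁ := by omega
  have hM : ((2 * d₁ - 1 : ℕ) : ℝ) = 2 * d₁ - 1 := by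
    rw [Nat.cast_sub (by omega)]; push_cast; rfl
  have hN : ((d₁ + d₂ - 1 : ℕ) : ℝ) = d₁ + d₂ - 1 := by
    rw [Nat.cast_sub (by omega)]; push_cast; rfl
  have hP : ((d₁ - 1 : ℕ) : ℝ) = d₁ - 1 := by
    rw [Nat.cast_sub (by omega)]; push_cast; rfl
  rw [newtonPolytope, expVecs_rename_jetVar, Nat.cast_mul, Nat.cast_mul, hM, hN]
  refine convexHull_eq_truncated_simplex (by exact_mod_cast (by omega : 1 < d₁))
    (by exact_mod_cast hd₂) ?_ ?_ ?_ ?_ ?_ ?_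
  · rintro _ ⟨m, hm, rfl⟩
    have hb := weight_bound_eliminant (d₁ := d₁) (d₂ := d₂) (N := 2 * d₁ - 1) (k := d₁) hd₁ le_rfl
      (by omega) (by omega) h₁ h₂ hm
    have hb' := weight_bound_eliminant (d₁ := d₁) (d₂ := d₂) (N := d₁ + d₂ - 1) (k := d₂) hd₁
      hlt.le (by omega) le_rfl h₁ h₂ hm
    refine ⟨fun k => by fin_cases k <;> simp, ?_, ?_⟩
    · rw [← hM, ← Nat.cast_mul]
      simp only [Matrix.cons_val]
      norm_cast
      linarith
    · rw [← hN, ← Nat.cast_mul]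
      simp only [Matrix.cons_val]
      norm_cast
      linarith
  · exact ⟨0, mem_support_iff.2 h.coeff_zero, by ext k; fin_cases k <;> simp⟩
  · exact ⟨_, mem_support_iff.2 h.coeff_single_one, by ext k; fin_cases k <;> simp [hN]⟩
  · exact ⟨_, mem_support_iff.2 (h.coeff_single_two_of_lt hlt), by
      ext k; fin_cases k <;> simp [hM]⟩
  · exact ⟨_, mem_support_iff.2 h.coeff_single_zero, by ext k; fin_cases k <;> simp⟩
  · exact ⟨_, mem_support_iff.2 (h.coeff_mixed hlt), by ext k; fin_cases k <;> simp [hP]⟩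

theorem solutionHom_rename_jetVar (q : MvPolynomial (Fin 3) K) :
    solutionHom ![g₁, g₂] (rename jetVar q) = aeval ![accel g₁ g₂, X 0, g₁] q := by
  rw [solutionHom, aeval_rename]
  congr 2
  ext i : 1
  have hder : ∀ p : MvPolynomial (Fin 2) K,
      lieDer ![g₁, g₂] p = g₁ * pderiv 0 p + g₂ * pderiv 1 p := by
    intro p
    have hD : lieDer ![g₁, g₂] = g₁ • pderiv 0 + g₂ • pderiv 1 := by
      refine derivation_ext fun i => ?_
      fin_cases i <;> simp [lieDer]
    simp [hD]
  fin_cases i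
  · simp [jetVar, hder, accel]
  · simp [jetVar]
  · simp [jetVar, lieDer]

theorem ordOf_le_iff (f : MvPolynomial (Fin 2 × ℕ) K) (n : ℕ) :
    ordOf f ≤ n ↔ ∀ v ∈ f.vars, v.2 ≤ n := Finset.sup_le_iff

theorem exists_rename_jetVar_eq {f : MvPolynomial (Fin 2 × ℕ) K} (hf : ordOf f ≤ 2)
    (hv : ∀ v ∈ f.vars, v.1 = 0) : ∃ q, rename jetVar q = f := by
  refine exists_rename_eq_of_vars_subset_range f jetVar jetVar_injective ?_
  intro v hvm
  have h₁ := (ordOf_le_iff f 2).1 hf v hvm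
  have h₂ := hv v hvm
  obtain ⟨i, j⟩ := v
  subst h₂
  interval_cases j
  exacts [⟨1, rfl⟩, ⟨2, rfl⟩, ⟨0, rfl⟩]

theorem vars_rename_jetVar_fst (q : MvPolynomial (Fin 3) K) :
    ∀ v ∈ (rename jetVar q).vars, v.1 = 0 := by
  classical
  intro v hv
  obtain ⟨i, -, rfl⟩ := Finset.mem_image.1 (vars_rename jetVar q hv)
  fin_cases i <;> rfl

theorem ordOf_rename_jetVar_le (q : MvPolynomial (Fin 3) K) : ordOf (rename jetVar q) ≤ 2 := by
  classical
  refine (ordOf_le_iff _ _).2 fun v hv => ?_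
  obtain ⟨i, -, rfl⟩ := Finset.mem_image.1 (vars_rename jetVar q hv)
  fin_cases i <;> simp [jetVar]

theorem two_le_ordOf_rename_jetVar {q : MvPolynomial (Fin 3) K} (hq : q.degreeOf 0 ≠ 0) :
    2 ≤ ordOf (rename jetVar q) := by
  classical
  have h : (0, 2) ∈ (rename jetVar q).vars := by
    have : (rename jetVar q).degreeOf (jetVar 0) ≠ 0 := by
      rwa [degreeOf_rename_of_injective jetVar_injective]
    rwa [degreeOf_def, Multiset.count_ne_zero, ← Multiset.mem_toFinset, ← vars_def] at this
  exact Finset.le_sup (f := Prod.snd) h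

theorem degreeOf_ne_zero_of_dvd {F q : MvPolynomial (Fin 3) K} (hq : q ≠ 0) (h : F ∣ q)
    (hF : F.degreeOf 0 ≠ 0) : q.degreeOf 0 ≠ 0 := by
  obtain ⟨r, rfl⟩ := h
  rw [degreeOf_mul_eq (left_ne_zero_of_mul hq) (right_ne_zero_of_mul hq)]
  omega

theorem totalDegree_rename_jetVar (q : MvPolynomial (Fin 3) K) :
    (rename jetVar q).totalDegree = q.totalDegree := by
  classical
  rw [totalDegree, totalDegree, support_rename_of_injective jetVar_injective, Finset.sup_image]
  exact Finset.sup_congr rfl fun m _ =>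
    Finsupp.sum_mapDomain_index (h := fun _ e => e) (fun _ => rfl) fun _ _ _ => rfl

theorem degreeOf_eliminant_ne_zero (hd₁ : 0 < d₁) (h : IsGeneric d₁ d₂ g₁ g₂) :
    (eliminant d₁ d₂ g₁ g₂).degreeOf 0 ≠ 0 := by
  have := monomial_le_degreeOf 0 (mem_support_iff.2 h.coeff_single_zero)
  simp at this
  omega

theorem ordOf_eliminant (hd₁ : 0 < d₁) (h : IsGeneric d₁ d₂ g₁ g₂) :
    ordOf (rename jetVar (eliminant d₁ d₂ g₁ g₂)) = 2 :=
  le_antisymm (ordOf_rename_jetVar_le _)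
    (two_le_ordOf_rename_jetVar (degreeOf_eliminant_ne_zero hd₁ h))

theorem dvd_of_mem_sysIdeal (hd₁ : 0 < d₁) (hd₂ : 0 < d₂)
    (h₁ : ∀ m ∈ g₁.support, m 0 + m 1 ≤ d₁) (h₂ : ∀ m ∈ g₂.support, m 0 + m 1 ≤ d₂)
    (h : IsGeneric d₁ d₂ g₁ g₂) {q : MvPolynomial (Fin 3) K}
    (hq : rename jetVar q ∈ sysIdeal K 2 ![g₁, g₂]) : eliminant d₁ d₂ g₁ g₂ ∣ q := by
  rw [mem_sysIdeal, solutionHom_rename_jetVar] at hq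
  exact eliminant_dvd hd₁ hd₂ h₁ h₂ h.coeff_ne_zero h.coeff_single_zero h.separable hq

theorem eliminant_ne_zero (h : IsGeneric d₁ d₂ g₁ g₂) : eliminant d₁ d₂ g₁ g₂ ≠ 0 :=
  fun h0 => h.coeff_zero (by rw [h0, coeff_zero])

theorem isMinPoly_eliminant (hd₁ : 0 < d₁) (hd₂ : 0 < d₂)
    (h₁ : ∀ m ∈ g₁.support, m 0 + m 1 ≤ d₁) (h₂ : ∀ m ∈ g₂.support, m 0 + m 1 ≤ d₂)
    (h : IsGeneric d₁ d₂ g₁ g₂) :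
    IsMinPoly K 2 (sysIdeal K 2 ![g₁, g₂]) (rename jetVar (eliminant d₁ d₂ g₁ g₂)) := by
  refine ⟨(map_ne_zero_iff _ (rename_injective _ jetVar_injective)).2 (eliminant_ne_zero h), ?_,
    vars_rename_jetVar_fst _, fun f hf0 hfI hfv => ?_⟩
  · rw [mem_sysIdeal, solutionHom_rename_jetVar]
    exact aeval_eliminant d₁ d₂ hd₁ g₁ g₂ h₁ h₂
  · rw [ordOf_eliminant hd₁ h]
    rcases le_or_gt (ordOf f) 2 with hf | hf
    · obtain ⟨q, rfl⟩ := exists_rename_jetVar_eq hf hfv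
      have hq0 : q ≠ 0 := by rintro rfl; exact hf0 (map_zero _)
      have hdvd := dvd_of_mem_sysIdeal hd₁ hd₂ h₁ h₂ h hfI
      refine ⟨two_le_ordOf_rename_jetVar
        (degreeOf_ne_zero_of_dvd hq0 hdvd (degreeOf_eliminant_ne_zero hd₁ h)), fun _ => ?_⟩
      rw [totalDegree_rename_jetVar, totalDegree_rename_jetVar]
      exact totalDegree_le_of_dvd_of_isDomain hdvd hq0
    · exact ⟨hf.le, fun h => absurd h hf.not_ge⟩

theorem IsMinPoly.eq_C_mul_eliminant (hd₁ : 0 < d₁) (hd₂ : 0 < d₂)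
    (h₁ : ∀ m ∈ g₁.support, m 0 + m 1 ≤ d₁) (h₂ : ∀ m ∈ g₂.support, m 0 + m 1 ≤ d₂)
    (h : IsGeneric d₁ d₂ g₁ g₂) {f : MvPolynomial (Fin 2 × ℕ) K}
    (hf : IsMinPoly K 2 (sysIdeal K 2 ![g₁, g₂]) f) :
    ∃ c : K, c ≠ 0 ∧ f = rename jetVar (C c * eliminant d₁ d₂ g₁ g₂) := by
  obtain ⟨hf0, hfI, hfv, hmin⟩ := hf
  have hF := isMinPoly_eliminant hd₁ hd₂ h₁ h₂ h
  obtain ⟨hle, hdeg⟩ := hmin _ hF.1 hF.2.1 hF.2.2.1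
  have hge := (hF.2.2.2 f hf0 hfI hfv).1
  have hdeg := hdeg hge
  obtain ⟨q, rfl⟩ := exists_rename_jetVar_eq (hle.trans (ordOf_rename_jetVar_le _)) hfv
  obtain ⟨r, rfl⟩ := dvd_of_mem_sysIdeal hd₁ hd₂ h₁ h₂ h hfI
  have hr0 : r ≠ 0 := by rintro rfl; exact hf0 (by simp)
  rw [totalDegree_rename_jetVar, totalDegree_rename_jetVar,
    totalDegree_mul_of_isDomain (eliminant_ne_zero h) hr0] at hdeg
  have hr := totalDegree_eq_zero_iff_eq_C.1 (by omega : r.totalDegree = 0)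
  refine ⟨coeff 0 r, fun hc => hr0 (by rw [hr, hc, C_0]), ?_⟩
  rw [← hr, mul_comm]

theorem support_C_mul_of_ne_zero {σ : Type*} {c : K} (hc : c ≠ 0) (p : MvPolynomial σ K) :
    (C c * p).support = p.support := by
  ext m
  simp [mem_support_iff, coeff_C_mul, hc]

theorem newtonPolytope_rename_C_mul {c : K} (hc : c ≠ 0) (F : MvPolynomial (Fin 3) K) :
    newtonPolytope K 2 2 (rename jetVar (C c * F)) = newtonPolytope K 2 2 (rename jetVar F) := by
  rw [newtonPolytope, newtonPolytope, expVecs_rename_jetVar, expVecs_rename_jetVar,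
    support_C_mul_of_ne_zero hc]

end

theorem statement1 (K : Type*) [Field K] [CharZero K] (d₁ d₂ : ℕ)
    (hd₁ : 0 < d₁) (hd₂ : 0 < d₂) :
    ∃ P : MvPolynomial ((Fin 2 →₀ ℕ) ⊕ (Fin 2 →₀ ℕ)) K, P ≠ 0 ∧
      (∀ m : Fin 2 →₀ ℕ,
        (Sum.inl m ∈ P.vars → m 0 + m 1 ≤ d₁) ∧ (Sum.inr m ∈ P.vars → m 0 + m 1 ≤ d₂)) ∧
      ∀ g₁ g₂ : MvPolynomial (Fin 2) K,
        g₁.totalDegree ≤ d₁ → g₂.totalDegree ≤ d₂ →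
        MvPolynomial.eval (Sum.elim (fun m => MvPolynomial.coeff m g₁)
          (fun m => MvPolynomial.coeff m g₂)) P ≠ 0 →
        (∃ f, IsMinPoly K 2 (sysIdeal K 2 ![g₁, g₂]) f) ∧
        ∀ f : MvPolynomial (Fin 2 × ℕ) K, IsMinPoly K 2 (sysIdeal K 2 ![g₁, g₂]) f →
          ordOf f ≤ 2 ∧
          ((d₁ ≤ d₂ →
            newtonPolytope K 2 2 f =
              {e : Fin 3 → ℝ | (∀ k, 0 ≤ e k) ∧
                e 0 + (d₁ : ℝ) * e 1 + ((d₁ + d₂ - 1 : ℕ) : ℝ) * e 2 ≤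
                  ((d₁ * (d₁ + d₂ - 1) : ℕ) : ℝ)}) ∧
          (d₂ < d₁ →
            newtonPolytope K 2 2 f =
              {e : Fin 3 → ℝ | (∀ k, 0 ≤ e k) ∧
                e 0 + (d₁ : ℝ) * e 1 + ((2 * d₁ - 1 : ℕ) : ℝ) * e 2 ≤
                  ((d₁ * (2 * d₁ - 1) : ℕ) : ℝ) ∧
                e 0 + (d₂ : ℝ) * e 1 + ((d₁ + d₂ - 1 : ℕ) : ℝ) * e 2 ≤
                  ((d₁ * (d₁ + d₂ - 1) : ℕ) : ℝ)})) := by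
  obtain ⟨P, hP, hPv, hPe⟩ := holdsGenerically_isGeneric (K := K) (d₂ := d₂) hd₁
  refine ⟨P, hP, hPv, fun g₁ g₂ h₁ h₂ he => ?_⟩
  have h₁ := degree_le_of_totalDegree_le h₁
  have h₂ := degree_le_of_totalDegree_le h₂
  have h := hPe g₁ g₂ h₁ h₂ he
  refine ⟨⟨_, isMinPoly_eliminant hd₁ hd₂ h₁ h₂ h⟩, fun f hf => ?_⟩
  obtain ⟨c, hc, rfl⟩ := hf.eq_C_mul_eliminant hd₁ hd₂ h₁ h₂ h
  rw [newtonPolytope_rename_C_mul hc]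
  exact ⟨ordOf_rename_jetVar_le _,
    fun hle => newtonPolytope_eliminant_of_le hd₁ hle h₁ h₂ h,
    fun hlt => newtonPolytope_eliminant_of_lt hd₂ hlt h₁ h₂ h⟩
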